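/- For k ≥ 2, let T be a feasible connected digraph of order k. Suppose f has bounded support, rₙ → 0 as n → ∞, and there is a constant δ > 0 such that liminf_{n→∞} n^{2k−1−δ}·rₙ^{4(k−1)} > 0. Then, almost surely, n^{−k}·rₙ^{−2(k−1)}·H_{n,T} → μ_T as n → ∞. -/

import Mathlib

open MeasureTheory ProbabilityTheory Filter Real Set
open scoped Topology

noncomputable section

/-- The circular sector with apex `x`, radius `r`, central angle `a` and
inclination `y` (measured anticlockwise from the horizontal direction). -/
def sector (a : ℝ) (x : ℂ) (y r : ℝ) : Set ℂ :=
  {z : ℂ | ‖z - x‖ ≤ r ∧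
    ∃ t : ℝ, y ≤ t ∧ t ≤ y + a ∧
      z - x = (‖z - x‖ : ℂ) * Complex.exp (t * Complex.I)}

/-- Arc relation of the sector digraph on the configuration `x` (points) and `y`
(inclinations) with cutoff `r`: there is an arc from `i` to `j` iff `i ≠ j` and
the point `x j` lies in the sector of `i`. -/
def arc (a r : ℝ) {n : ℕ} (x : Fin n → ℂ) (y : Fin n → ℝ) (i j : Fin n) : Prop :=
  i ≠ j ∧ x j ∈ sector a (x i) (y i) r

/-- The sector digraph (cutoff `r`) on the `k`-point configuration `(x, y)` is
isomorphic to the digraph `T` on `Fin k`. -/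
def isoT (a r : ℝ) {k : ℕ} (T : Fin k → Fin k → Prop) (x : Fin k → ℂ) (y : Fin k → ℝ) : Prop :=
  ∃ e : Equiv.Perm (Fin k), ∀ i j, T i j ↔ arc a r x y (e i) (e j)

/-- The number of induced subdigraphs of the sector digraph on the configuration
`(x, y)` with cutoff `r` that are isomorphic to `T`. -/
def inducedCount (a r : ℝ) {k : ℕ} (T : Fin k → Fin k → Prop) {n : ℕ}
    (x : Fin n → ℂ) (y : Fin n → ℝ) : ℕ :=
  Set.ncard {s : Finset (Fin n) |
    ∃ g : Fin k ↪ Fin n, Finset.univ.map g = s ∧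
      ∀ i j, T i j ↔ arc a r x y (g i) (g j)}

/-- The number of isolated induced subdigraphs of the sector digraph on the
configuration `(x, y)` with cutoff `r` that are isomorphic to `T`: `k`-element
vertex subsets inducing a digraph isomorphic to `T` with no arc leaving the subset. -/
def isolatedCount (a r : ℝ) {k : ℕ} (T : Fin k → Fin k → Prop) {n : ℕ}
    (x : Fin n → ℂ) (y : Fin n → ℝ) : ℕ :=
  Set.ncard {s : Finset (Fin n) |
    (∃ g : Fin k ↪ Fin n, Finset.univ.map g = s ∧
      ∀ i j, T i j ↔ arc a r x y (g i) (g j)) ∧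
    ∀ i ∈ s, ∀ j, j ∉ s → ¬ arc a r x y i j}

open Classical in
/-- The indicator function `h_T`: equal to `1` if the sector digraph with radius `1`
on the configuration `(x, y)` is isomorphic to `T`, and `0` otherwise. -/
def hInd (a : ℝ) {k : ℕ} (T : Fin k → Fin k → Prop) (x : Fin k → ℂ) (y : Fin k → ℝ) : ℝ :=
  if isoT a 1 T x y then 1 else 0

/-- The `k`-point configuration `(0, z 1, …, z (k-1))`. -/
def pts {k : ℕ} (z : Fin (k - 1) → ℂ) (i : Fin k) : ℂ :=
  if h : (i : ℕ) = 0 then 0 else z ⟨(i : ℕ) - 1, by have := i.isLt; omega⟩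

/-- The Lebesgue measure of `S(x₁,…,x_k,y₁,…,y_k) = ∪_{i=1}^k S(xᵢ,yᵢ,1)`. -/
def sectorUnionVol (a : ℝ) {k : ℕ} (x : Fin k → ℂ) (y : Fin k → ℝ) : ℝ :=
  (volume (⋃ i, sector a (x i) (y i) 1)).toReal

/-- The function `φ_T`. -/
def phiT (a : ℝ) (k : ℕ) (T : Fin k → Fin k → Prop) (t : ℝ) : ℝ :=
  if k = 1 then Real.exp (-(t * a) / 2)
  else (t ^ (k - 1) / ((k - 1).factorial * (2 * π) ^ k)) *
    ∫ y in Set.univ.pi (fun _ : Fin k => Set.Ico 0 (2 * π)),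
      ∫ z : Fin (k - 1) → ℂ,
        hInd a T (pts z) y * Real.exp (-t * sectorUnionVol a (pts z) y)

/-- The constant `μ_T`. -/
def muT (a : ℝ) (k : ℕ) (T : Fin k → Fin k → Prop) (f : ℂ → ℝ) : ℝ :=
  (1 / (k.factorial * (2 * π) ^ k)) *
    ∫ y in Set.univ.pi (fun _ : Fin k => Set.Ico 0 (2 * π)),
      ∫ z : Fin (k - 1) → ℂ, ∫ x : ℂ, hInd a T (pts z) y * f x ^ k


lemma rem_bound (x d M : ℝ) (hx : |x| ≤ M) (hd : |d| ≤ M) (n : ℕ) :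
    |(x + d) ^ (n + 2) - x ^ (n + 2) - (n + 2) * x ^ (n + 1) * d| ≤ 4 ^ (n + 1) * d ^ 2 * M ^ n := by
  have hM : 0 ≤ M := (abs_nonneg x).trans hx
  induction n with
  | zero =>
    have : (x + d) ^ (0 + 2) - x ^ (0 + 2) - ((0 : ℕ) + 2) * x ^ (0 + 1) * d = d ^ 2 := by
      push_cast; ring
    rw [this, abs_of_nonneg (sq_nonneg d)]
    simp only [zero_add, pow_one, pow_zero, mul_one]
    nlinarith [sq_nonneg d]
  | succ n ih =>
    have e : (x + d) ^ (n + 1 + 2) - x ^ (n + 1 + 2) - ((n + 1 : ℕ) + 2) * x ^ (n + 1 + 1) * d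
      = (x + d) * ((x + d) ^ (n + 2) - x ^ (n + 2) - (n + 2) * x ^ (n + 1) * d)
        + (n + 2) * x ^ (n + 1) * d ^ 2 := by push_cast; ring
    rw [e]
    refine (abs_add_le _ _).trans ?_
    rw [abs_mul, abs_mul, abs_mul, abs_pow, abs_of_nonneg (sq_nonneg d),
      abs_of_nonneg (by positivity : (0:ℝ) ≤ n + 2)]
    have h1 : |x + d| ≤ 2 * M := (abs_add_le _ _).trans (by linarith)
    have h2 : |x| ^ (n + 1) ≤ M ^ (n + 1) := by gcongr
    have h3 : ((n : ℝ) + 2) ≤ 2 * 4 ^ (n + 1) := by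
      have : n + 2 ≤ 2 * 4 ^ (n + 1) := by
        have := Nat.lt_pow_self (n := n + 1) (show 1 < 4 by norm_num)
        omega
      exact_mod_cast this
    calc |x + d| * |(x + d) ^ (n + 2) - x ^ (n + 2) - (n + 2) * x ^ (n + 1) * d|
          + (n + 2) * |x| ^ (n + 1) * d ^ 2
        ≤ (2 * M) * (4 ^ (n + 1) * d ^ 2 * M ^ n) + (2 * 4 ^ (n + 1)) * M ^ (n + 1) * d ^ 2 := by
          gcongr
      _ = 4 ^ (n + 1 + 1) * d ^ 2 * M ^ (n + 1) := by ring

lemma point_ineq (m : ℕ) : ∃ K : ℝ, 0 ≤ K ∧ ∀ N : ℝ, 1 ≤ N → ∀ x d : ℝ,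
    (x + d) ^ (2 * (m + 1)) ≤ (1 + 1 / N) * x ^ (2 * (m + 1))
      + (2 * m + 2) * x ^ (2 * m + 1) * d + K * N ^ m * d ^ (2 * (m + 1)) := by
  set B : ℝ := 4 ^ (2 * m + 1) with hB
  have hB1 : 1 ≤ B := one_le_pow₀ (by norm_num)
  refine ⟨B * B ^ m, by positivity, fun N hN x d => ?_⟩
  have e2 : 2 * (m + 1) = 2 * m + 2 := by ring
  have hxe : 0 ≤ x ^ (2 * (m + 1)) := by rw [pow_mul]; positivity
  have hde : 0 ≤ d ^ (2 * (m + 1)) := by rw [pow_mul]; positivity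
  by_cases h : B * N * d ^ 2 ≤ x ^ 2
  · have hdx : |d| ≤ |x| := by
      apply sq_le_sq.mp
      have : 1 * d ^ 2 ≤ B * N * d ^ 2 := by
        gcongr; nlinarith
      linarith
    have := rem_bound x d |x| le_rfl hdx (2 * m)
    have h4 := (le_abs_self _).trans this
    rw [← hB] at h4
    have h5 : B * d ^ 2 * |x| ^ (2 * m) ≤ 1 / N * x ^ (2 * (m + 1)) := by
      rw [pow_mul, sq_abs, e2, pow_add, pow_mul]
      have h6 : B * d ^ 2 ≤ 1 / N * x ^ 2 := by
        rw [one_div, inv_mul_eq_div, le_div_iff₀ (by linarith)]; linarith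
      calc B * d ^ 2 * (x ^ 2) ^ m ≤ (1 / N * x ^ 2) * (x ^ 2) ^ m := by gcongr
        _ = _ := by ring
    have h7 : 0 ≤ B * B ^ m * N ^ m * d ^ (2 * (m + 1)) := by positivity
    push_cast at h4
    rw [← e2] at h4
    linarith
  · push Not at h
    set M := √(B * N * d ^ 2)
    have hM2 : M ^ 2 = B * N * d ^ 2 := Real.sq_sqrt (by positivity)
    have hxM : |x| ≤ M := Real.abs_le_sqrt h.le
    have hdM : |d| ≤ M := Real.abs_le_sqrt (by
      have : 1 * d ^ 2 ≤ B * N * d ^ 2 := by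
        gcongr; nlinarith
      linarith)
    have := rem_bound x d M hxM hdM (2 * m)
    have h4 := (le_abs_self _).trans this
    rw [← hB, pow_mul M, hM2] at h4
    have h5 : B * d ^ 2 * (B * N * d ^ 2) ^ m = B * B ^ m * N ^ m * d ^ (2 * (m + 1)) := by
      rw [mul_pow, mul_pow, e2, pow_add d, pow_mul d]; ring
    have h7 : 0 ≤ 1 / N * x ^ (2 * (m + 1)) := by positivity
    push_cast at h4
    rw [← e2] at h4
    linarith

lemma bint {α : Type*} [MeasurableSpace α] {μ : Measure α} [IsFiniteMeasure μ] {F : α → ℝ}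
    (hF : Measurable F) (hb : ∃ C, ∀ x, |F x| ≤ C) : Integrable F μ := by
  obtain ⟨C, hC⟩ := hb
  exact Integrable.of_bound hF.aestronglyMeasurable C (Eventually.of_forall hC)

lemma bpow {α : Type*} {F : α → ℝ} (hb : ∃ C, ∀ x, |F x| ≤ C) (q : ℕ) :
    ∃ C, ∀ x, |F x ^ q| ≤ C := by
  obtain ⟨C, hC⟩ := hb
  refine ⟨C ^ q, fun x => ?_⟩
  rw [abs_pow]; exact pow_le_pow_left₀ (abs_nonneg _) (hC x) q

lemma jensen_pow {α : Type*} [MeasurableSpace α] {μ : Measure α} [IsProbabilityMeasure μ]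
    {F : α → ℝ} (hF : Measurable F) (hb : ∃ C, ∀ x, |F x| ≤ C) (m : ℕ) :
    (∫ x, F x ∂μ) ^ (2 * m) ≤ ∫ x, F x ^ (2 * m) ∂μ := by
  exact ConvexOn.map_integral_le (s := univ) (g := fun t : ℝ => t ^ (2 * m))
    (Even.convexOn_pow (even_two_mul m)) (by fun_prop) isClosed_univ (by simp)
    (bint hF hb) (bint (hF.pow_const _) (bpow hb _))

lemma center_pow {α : Type*} [MeasurableSpace α] {μ : Measure α} [IsProbabilityMeasure μ]
    {F : α → ℝ} (hF : Measurable F) (hb : ∃ C, ∀ x, |F x| ≤ C) (m : ℕ) :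
    ∫ x, (F x - ∫ t, F t ∂μ) ^ (2 * m) ∂μ ≤ 4 ^ m * ∫ x, F x ^ (2 * m) ∂μ := by
  set c := ∫ t, F t ∂μ with hc
  have hp : ∀ x, (F x - c) ^ (2 * m) ≤ 4 ^ m / 2 * (F x ^ (2 * m) + c ^ (2 * m)) := by
    intro x
    rcases Nat.eq_zero_or_pos m with rfl | hm
    · norm_num
    have h1 : (F x - c) ^ 2 ≤ 2 * (F x ^ 2 + c ^ 2) := by nlinarith [sq_nonneg (F x + c)]
    have h2 := add_pow_le (sq_nonneg (F x)) (sq_nonneg c) m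
    rw [pow_mul, pow_mul, pow_mul]
    calc ((F x - c) ^ 2) ^ m ≤ (2 * (F x ^ 2 + c ^ 2)) ^ m := by gcongr
      _ = 2 ^ m * (F x ^ 2 + c ^ 2) ^ m := by rw [mul_pow]
      _ ≤ 2 ^ m * (2 ^ (m - 1) * ((F x ^ 2) ^ m + (c ^ 2) ^ m)) := by gcongr
      _ = _ := by
        obtain ⟨l, rfl⟩ : ∃ l, m = l + 1 := ⟨m - 1, by omega⟩
        simp only [Nat.add_sub_cancel]
        rw [show (4:ℝ) = 2 * 2 by norm_num, mul_pow]; ring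
  have hi1 : Integrable (fun x => F x ^ (2 * m)) μ := bint (hF.pow_const _) (bpow hb _)
  have hi2 : Integrable (fun x => (F x - c) ^ (2 * m)) μ := by
    refine bint ((hF.sub_const _).pow_const _) (bpow ?_ _)
    obtain ⟨C, hC⟩ := hb
    exact ⟨C + |c|, fun x => (abs_sub _ _).trans (by linarith [hC x])⟩
  calc ∫ x, (F x - c) ^ (2 * m) ∂μ ≤ ∫ x, 4 ^ m / 2 * (F x ^ (2 * m) + c ^ (2 * m)) ∂μ :=
        integral_mono hi2 ((hi1.add (integrable_const _)).const_mul _) hp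
    _ = 4 ^ m / 2 * (∫ x, F x ^ (2 * m) ∂μ + c ^ (2 * m)) := by
        rw [integral_const_mul, integral_add hi1 (integrable_const _)]; simp
    _ ≤ 4 ^ m / 2 * (∫ x, F x ^ (2 * m) ∂μ + ∫ x, F x ^ (2 * m) ∂μ) := by
        gcongr; exact jensen_pow hF hb m
    _ = _ := by ring

section
variable {E : Type*} [MeasurableSpace E] (μ : Measure E) [IsProbabilityMeasure μ]

lemma integral_cons {n : ℕ} (F : (Fin (n + 1) → E) → ℝ) (hF : Measurable F)
    (hb : ∃ C, ∀ x, |F x| ≤ C) :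
    ∫ x, F x ∂(Measure.pi fun _ => μ) =
      ∫ y, ∫ t, F (Fin.cons t y) ∂μ ∂(Measure.pi fun _ : Fin n => μ) := by
  have h := (measurePreserving_piFinSuccAbove (fun _ : Fin (n + 1) => μ) 0).symm
  rw [← h.integral_comp (MeasurableEquiv.measurableEmbedding _)]
  rw [integral_prod_symm]
  · have : ∀ (t : E) (y : Fin n → E),
        (MeasurableEquiv.piFinSuccAbove (fun _ : Fin (n + 1) => E) 0).symm (t, y) = Fin.cons t y := by
      intro t y
      rw [MeasurableEquiv.piFinSuccAbove_symm_apply]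
      exact Fin.insertNth_zero' t y
    simp only [this]
  · exact bint (hF.comp (MeasurableEquiv.measurable _)) ⟨hb.choose, fun x => hb.choose_spec _⟩

lemma meas_cons {n : ℕ} : Measurable (fun p : E × (Fin n → E) => (Fin.cons p.1 p.2 : Fin (n + 1) → E)) := by
  rw [measurable_pi_iff]
  intro i
  refine Fin.cases ?_ (fun j => ?_) i
  · simpa using measurable_fst
  · simp only [Fin.cons_succ]; fun_prop

lemma meas_bar {n : ℕ} (F : (Fin (n + 1) → E) → ℝ) (hF : Measurable F) :
    Measurable (fun y => ∫ t, F (Fin.cons t y) ∂μ) := by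
  have : StronglyMeasurable (fun p : (Fin n → E) × E => F (Fin.cons p.2 p.1)) :=
    (hF.comp (meas_cons.comp measurable_swap)).stronglyMeasurable
  exact this.integral_prod_right.measurable

lemma bdd_bar {n : ℕ} (F : (Fin (n + 1) → E) → ℝ)
    (hb : ∃ C, ∀ x, |F x| ≤ C) : ∃ C, ∀ y : Fin n → E, |∫ t, F (Fin.cons t y) ∂μ| ≤ C := by
  obtain ⟨C, hC⟩ := hb
  refine ⟨C, fun y => ?_⟩
  have := norm_integral_le_of_norm_le_const (μ := μ) (f := fun t => F (Fin.cons t y)) (C := C)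
    (Eventually.of_forall fun t => hC _)
  simpa using this

theorem moment_ineq (m : ℕ) (K N : ℝ) (hK : 0 ≤ K) (hN : 1 ≤ N)
    (hpt : ∀ x d : ℝ, (x + d) ^ (2 * (m + 1)) ≤ (1 + 1 / N) * x ^ (2 * (m + 1))
      + (2 * m + 2) * x ^ (2 * m + 1) * d + K * N ^ m * d ^ (2 * (m + 1)))
    (b : ℝ) (hb0 : 0 ≤ b) (n : ℕ) :
    ∀ (F : (Fin n → E) → ℝ) (D : Fin n → (Fin n → E) → ℝ), Measurable F →
      (∃ C, ∀ x, |F x| ≤ C) → (∀ i, Measurable (D i)) → (∀ i, ∃ C, ∀ x, |D i x| ≤ C) →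
      (∀ i x e, F (Function.update x i e) - D i (Function.update x i e) = F x - D i x) →
      (∀ i, ∫ x, D i x ^ (2 * (m + 1)) ∂(Measure.pi fun _ => μ) ≤ b) →
      ∫ x, (F x - ∫ z, F z ∂(Measure.pi fun _ => μ)) ^ (2 * (m + 1)) ∂(Measure.pi fun _ => μ)
        ≤ (1 + 1 / N) ^ n * n * (K * N ^ m * (4 ^ (m + 1) * b)) := by
  induction n with
  | zero =>
    intro F D _ _ _ _ _ _
    have : ∀ x, F x = F default := fun x => by rw [Subsingleton.elim x default]
    simp [this]
  | succ n ih =>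
    intro F D hF hFb hD hDb hFD hbd
    set Fb : (Fin n → E) → ℝ := fun y => ∫ t, F (Fin.cons t y) ∂μ with hFbd
    set Db : Fin n → (Fin n → E) → ℝ := fun i y => ∫ t, D i.succ (Fin.cons t y) ∂μ with hDbd
    have hsec : ∀ (G : (Fin (n + 1) → E) → ℝ), Measurable G → ∀ y : Fin n → E,
        Measurable (fun t => G (Fin.cons t y)) := fun G hG y =>
      hG.comp (meas_cons.comp (measurable_id.prodMk measurable_const))
    have hsecb : ∀ (G : (Fin (n + 1) → E) → ℝ), (∃ C, ∀ x, |G x| ≤ C) → ∀ y : Fin n → E,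
        ∃ C, ∀ t, |G (Fin.cons t y)| ≤ C := fun G hG y => ⟨hG.choose, fun t => hG.choose_spec _⟩
    have ih' := ih Fb Db (meas_bar μ F hF) (bdd_bar μ F hFb) (fun i => meas_bar μ _ (hD _))
      (fun i => bdd_bar μ _ (hDb _)) ?_ ?_
    rotate_left
    · intro i y e
      simp only [hFbd, hDbd]
      rw [← integral_sub (bint (hsec _ hF _) (hsecb _ hFb _)) (bint (hsec _ (hD _) _) (hsecb _ (hDb _) _)),
       ← integral_sub (bint (hsec _ hF _) (hsecb _ hFb _)) (bint (hsec _ (hD _) _) (hsecb _ (hDb _) _))]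
      congr 1; ext t
      rw [Fin.cons_update]
      exact hFD _ _ _
    · intro i
      refine le_trans ?_ (hbd i.succ)
      rw [integral_cons μ _ ((hD _).pow_const _) (bpow (hDb _) _)]
      refine integral_mono (bint ((meas_bar μ _ (hD _)).pow_const _) (bpow (bdd_bar μ _ (hDb _)) _))
        (bint (meas_bar μ (fun x => D i.succ x ^ (2 * (m + 1))) ((hD _).pow_const _))
          (bdd_bar μ (fun x => D i.succ x ^ (2 * (m + 1))) (bpow (hDb _) _))) (fun y => ?_)
      exact jensen_pow (hsec _ (hD _) y) (hsecb _ (hDb _) y) _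
    set c := ∫ z, F z ∂(Measure.pi fun _ => μ) with hc
    have hcb : ∫ z, Fb z ∂(Measure.pi fun _ => μ) = c := (integral_cons μ F hF hFb).symm
    rw [hcb] at ih'
    have hFc : ∃ C, ∀ x, |F x - c| ≤ C := by
      obtain ⟨C, hC⟩ := hFb
      exact ⟨C + |c|, fun x => (abs_sub _ _).trans (by linarith [hC x])⟩
    have hFbc : ∃ C, ∀ x, |Fb x - c| ≤ C := by
      obtain ⟨C, hC⟩ := bdd_bar μ F hFb
      exact ⟨C + |c|, fun x => (abs_sub _ _).trans (by linarith [hC x])⟩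
    rw [integral_cons μ _ ((hF.sub_const c).pow_const _) (bpow hFc _)]
    -- inner bound
    have inner : ∀ y : Fin n → E, ∫ t, (F (Fin.cons t y) - c) ^ (2 * (m + 1)) ∂μ ≤
        (1 + 1 / N) * (Fb y - c) ^ (2 * (m + 1)) + K * N ^ m * (4 ^ (m + 1) *
          ∫ t, D 0 (Fin.cons t y) ^ (2 * (m + 1)) ∂μ) := by
      intro y
      have mF := hsec F hF y
      have bF := hsecb F hFb y
      have mD := hsec (D 0) (hD 0) y
      have bD := hsecb (D 0) (hDb 0) y
      have hdiff : ∀ t, F (Fin.cons t y) - Fb y =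
          D 0 (Fin.cons t y) - ∫ s, D 0 (Fin.cons s y) ∂μ := by
        intro t
        have key : ∀ s, F (Fin.cons s y) = D 0 (Fin.cons s y) + (F (Fin.cons t y) - D 0 (Fin.cons t y)) := by
          intro s
          have := hFD 0 (Fin.cons t y) s
          rw [Fin.update_cons_zero] at this
          linarith
        have : Fb y = ∫ s, D 0 (Fin.cons s y) ∂μ + (F (Fin.cons t y) - D 0 (Fin.cons t y)) := by
          simp only [hFbd]
          rw [integral_congr_ae (Eventually.of_forall key), integral_add (bint mD bD) (integrable_const _)]
          simp
        rw [this]; ring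
      have bd : ∃ C, ∀ t, |F (Fin.cons t y) - Fb y| ≤ C := by
        obtain ⟨C, hC⟩ := bF
        exact ⟨C + |Fb y|, fun x => (abs_sub _ _).trans (by linarith [hC x])⟩
      have md : Measurable (fun t => F (Fin.cons t y) - Fb y) := mF.sub_const _
      have i1 : Integrable (fun t => (F (Fin.cons t y) - Fb y) ^ (2 * (m + 1))) μ :=
        bint (md.pow_const _) (bpow bd _)
      have h0 : ∫ t, (F (Fin.cons t y) - Fb y) ∂μ = 0 := by
        rw [integral_sub (bint mF bF) (integrable_const _)]
        simp [hFbd]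
      calc ∫ t, (F (Fin.cons t y) - c) ^ (2 * (m + 1)) ∂μ
          ≤ ∫ t, ((1 + 1 / N) * (Fb y - c) ^ (2 * (m + 1))
            + (2 * m + 2) * (Fb y - c) ^ (2 * m + 1) * (F (Fin.cons t y) - Fb y)
            + K * N ^ m * (F (Fin.cons t y) - Fb y) ^ (2 * (m + 1))) ∂μ := by
            refine integral_mono (bint ((mF.sub_const _).pow_const _) (bpow (hsecb (fun x => F x - c) hFc y) _))
              (((integrable_const _).add ((bint md bd).const_mul _)).add (i1.const_mul _)) (fun t => ?_)
            have := hpt (Fb y - c) (F (Fin.cons t y) - Fb y)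
            simpa using this
        _ = (1 + 1 / N) * (Fb y - c) ^ (2 * (m + 1))
            + K * N ^ m * ∫ t, (F (Fin.cons t y) - Fb y) ^ (2 * (m + 1)) ∂μ := by
            have j2 : Integrable (fun t => (2 * m + 2) * (Fb y - c) ^ (2 * m + 1) *
                (F (Fin.cons t y) - Fb y)) μ := (bint md bd).const_mul _
            have j1 : Integrable (fun t => (1 + 1 / N) * (Fb y - c) ^ (2 * (m + 1)) +
                (2 * m + 2) * (Fb y - c) ^ (2 * m + 1) * (F (Fin.cons t y) - Fb y)) μ :=
              (integrable_const _).add j2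
            rw [integral_add j1 (i1.const_mul _), integral_add (integrable_const _) j2,
              integral_const_mul _ (fun t => F (Fin.cons t y) - Fb y),
              integral_const_mul _ (fun t => (F (Fin.cons t y) - Fb y) ^ (2 * (m + 1))), h0]
            simp
        _ ≤ _ := by
            simp_rw [hdiff]
            gcongr
            exact center_pow mD bD _
    have iA : Integrable (fun y => (Fb y - c) ^ (2 * (m + 1))) (Measure.pi fun _ : Fin n => μ) :=
      bint (((meas_bar μ F hF).sub_const _).pow_const _) (bpow hFbc _)
    have iB : Integrable (fun y => ∫ t, D 0 (Fin.cons t y) ^ (2 * (m + 1)) ∂μ) (Measure.pi fun _ : Fin n => μ) :=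
      bint (meas_bar μ (fun x => D 0 x ^ (2 * (m + 1))) ((hD _).pow_const _))
          (bdd_bar μ (fun x => D 0 x ^ (2 * (m + 1))) (bpow (hDb _) _))
    have hN1 : (1:ℝ) ≤ 1 + 1 / N := by
      have : 0 ≤ 1 / N := by positivity
      linarith
    set Q := K * N ^ m * (4 ^ (m + 1) * b) with hQ
    have hQ0 : 0 ≤ Q := by positivity
    calc _ ≤ ∫ y, ((1 + 1 / N) * (Fb y - c) ^ (2 * (m + 1)) + K * N ^ m * (4 ^ (m + 1) *
          ∫ t, D 0 (Fin.cons t y) ^ (2 * (m + 1)) ∂μ)) ∂(Measure.pi fun _ : Fin n => μ) := by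
          refine integral_mono (bint (meas_bar μ (fun x => (F x - c) ^ (2 * (m + 1))) ((hF.sub_const c).pow_const _))
            (bdd_bar μ (fun x => (F x - c) ^ (2 * (m + 1))) (bpow hFc _)))
            ((iA.const_mul _).add ((iB.const_mul _).const_mul _)) inner
      _ = (1 + 1 / N) * ∫ y, (Fb y - c) ^ (2 * (m + 1)) ∂(Measure.pi fun _ : Fin n => μ)
          + K * N ^ m * (4 ^ (m + 1) * ∫ x, D 0 x ^ (2 * (m + 1)) ∂(Measure.pi fun _ => μ)) := by
          rw [integral_add (iA.const_mul _) ((iB.const_mul _).const_mul _), integral_const_mul,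
            integral_const_mul, integral_const_mul,
            integral_cons μ (fun x => D 0 x ^ (2 * (m + 1))) ((hD _).pow_const _) (bpow (hDb _) _)]
      _ ≤ (1 + 1 / N) * ((1 + 1 / N) ^ n * n * Q) + Q := by
          rw [hQ]
          gcongr
          exact hbd 0
      _ ≤ (1 + 1 / N) * ((1 + 1 / N) ^ n * n * Q) + (1 + 1 / N) ^ (n + 1) * Q := by
          gcongr
          exact le_mul_of_one_le_left hQ0 (one_le_pow₀ hN1)
      _ = _ := by push_cast; ring


lemma isClosed_sectorRel (a r : ℝ) (ha : 0 ≤ a) :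
    IsClosed {p : (ℂ × ℝ) × ℂ | p.2 ∈ sector a p.1.1 p.1.2 r} := by
  have h1 : IsClosed {p : (ℂ × ℝ) × ℂ | ‖p.2 - p.1.1‖ ≤ r} :=
    isClosed_le (by fun_prop) continuous_const
  have h2 : IsClosed {q : (Icc (0:ℝ) 1) × ((ℂ × ℝ) × ℂ) | q.2.2 - q.2.1.1 =
      (‖q.2.2 - q.2.1.1‖ : ℂ) * Complex.exp (((q.2.1.2 + (q.1 : ℝ) * a : ℝ) : ℂ) * Complex.I)} :=
    isClosed_eq (by fun_prop) (by fun_prop)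
  have h3 := isClosedMap_snd_of_compactSpace _ h2
  convert h1.inter h3 using 1
  ext p
  simp only [sector, mem_ofPred_eq, mem_inter_iff, mem_image, Prod.exists, exists_eq_right]
  refine and_congr_right fun _ => ⟨?_, ?_⟩
  · rintro ⟨t, h1, h2, h3⟩
    refine ⟨⟨(t - p.1.2) / a, by
      constructor
      · exact div_nonneg (by linarith) ha
      · exact div_le_one_of_le₀ (by linarith) ha⟩, ?_⟩
    have : p.1.2 + (t - p.1.2) / a * a = t := by
      rcases eq_or_lt_of_le ha with h | h
      · rw [← h]; rw [← h] at h2; simp; linarith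
      · field_simp; try ring
    simp only [this]; exact h3
  · rintro ⟨s, h⟩
    refine ⟨_, ?_, ?_, h⟩
    · have := s.2.1; nlinarith
    · have := s.2.2; nlinarith

lemma meas_arc (a r : ℝ) (ha : 0 ≤ a) {n : ℕ} (i j : Fin n) :
    MeasurableSet {w : Fin n → ℂ × ℝ | arc a r (fun i => (w i).1) (fun i => (w i).2) i j} := by
  by_cases h : i = j
  · simp [arc, h]
  · simp only [arc, ne_eq, h, not_false_eq_true, true_and]
    exact (isClosed_sectorRel a r ha).measurableSet.preimage
      (f := fun w : Fin n → ℂ × ℝ => (((w i).1, (w i).2), (w j).1)) (by fun_prop)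

def good (a r : ℝ) {k : ℕ} (T : Fin k → Fin k → Prop) {n : ℕ} (w : Fin n → ℂ × ℝ)
    (s : Finset (Fin n)) : Prop :=
  ∃ g : Fin k ↪ Fin n, Finset.univ.map g = s ∧
      ∀ i j, T i j ↔ arc a r (fun i => (w i).1) (fun i => (w i).2) (g i) (g j)

lemma meas_good (a r : ℝ) (ha : 0 ≤ a) {k : ℕ} (T : Fin k → Fin k → Prop) {n : ℕ}
    (s : Finset (Fin n)) : MeasurableSet {w : Fin n → ℂ × ℝ | good a r T w s} := by
  have : {w : Fin n → ℂ × ℝ | good a r T w s} = ⋃ g : Fin k ↪ Fin n,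
      ({w | Finset.univ.map g = s} ∩ ⋂ i, ⋂ j,
        {w | T i j ↔ arc a r (fun i => (w i).1) (fun i => (w i).2) (g i) (g j)}) := by
    ext w; simp [good]
  rw [this]
  refine MeasurableSet.iUnion fun g => (MeasurableSet.const _).inter
    (MeasurableSet.iInter fun i => MeasurableSet.iInter fun j => ?_)
  by_cases h : T i j
  · simpa [h] using meas_arc a r ha (g i) (g j)
  · convert (meas_arc a r ha (g i) (g j)).compl using 1
    ext w; simp [h]

lemma meas_isoT (a r : ℝ) (ha : 0 ≤ a) {k : ℕ} (T : Fin k → Fin k → Prop) :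
    MeasurableSet {w : Fin k → ℂ × ℝ | isoT a r T (fun i => (w i).1) (fun i => (w i).2)} := by
  have : {w : Fin k → ℂ × ℝ | isoT a r T (fun i => (w i).1) (fun i => (w i).2)} =
     ⋃ g : Equiv.Perm (Fin k), (⋂ i, ⋂ j,
        {w | T i j ↔ arc a r (fun i => (w i).1) (fun i => (w i).2) (g i) (g j)}) := by
    ext w; simp [isoT]
  rw [this]
  refine MeasurableSet.iUnion fun g => 
    (MeasurableSet.iInter fun i => MeasurableSet.iInter fun j => ?_)
  by_cases h : T i j
  · simpa [h] using meas_arc a r ha (g i) (g j)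
  · convert (meas_arc a r ha (g i) (g j)).compl using 1
    ext w; simp [h]

open Classical in
def cnt (a r : ℝ) {k : ℕ} (T : Fin k → Fin k → Prop) {n : ℕ} (w : Fin n → ℂ × ℝ) : ℝ :=
  ∑ s : Finset (Fin n), if good a r T w s then 1 else 0

open Classical in
def cntAt (a r : ℝ) {k : ℕ} (T : Fin k → Fin k → Prop) {n : ℕ} (i : Fin n)
    (w : Fin n → ℂ × ℝ) : ℝ :=
  ∑ s : Finset (Fin n), if i ∈ s ∧ good a r T w s then 1 else 0

open Classical in
lemma inducedCount_eq (a r : ℝ) {k : ℕ} (T : Fin k → Fin k → Prop) {n : ℕ} (w : Fin n → ℂ × ℝ) :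
    (inducedCount a r T (fun i => (w i).1) (fun i => (w i).2) : ℝ) = cnt a r T w := by
  unfold inducedCount cnt
  rw [Set.ncard_eq_toFinset_card', Finset.sum_boole]
  congr 2
  ext s
  simp only [Set.mem_toFinset, Finset.mem_filter, Finset.mem_univ, true_and]
  exact Iff.rfl

lemma cnt_meas (a r : ℝ) (ha : 0 ≤ a) {k : ℕ} (T : Fin k → Fin k → Prop) {n : ℕ} :
    Measurable (cnt a r T : (Fin n → ℂ × ℝ) → ℝ) := by
  unfold cnt
  refine Finset.measurable_fun_sum _ fun s _ => ?_
  exact Measurable.ite (meas_good a r ha T s) measurable_const measurable_const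

lemma cntAt_meas (a r : ℝ) (ha : 0 ≤ a) {k : ℕ} (T : Fin k → Fin k → Prop) {n : ℕ} (i : Fin n) :
    Measurable (cntAt a r T i : (Fin n → ℂ × ℝ) → ℝ) := by
  unfold cntAt
  refine Finset.measurable_fun_sum _ fun s _ => ?_
  refine Measurable.ite ?_ measurable_const measurable_const
  exact (MeasurableSet.const _).inter (meas_good a r ha T s)

lemma cnt_bdd (a r : ℝ) {k : ℕ} (T : Fin k → Fin k → Prop) {n : ℕ} :
    ∃ C, ∀ w : Fin n → ℂ × ℝ, |cnt a r T w| ≤ C := by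
  refine ⟨∑ s : Finset (Fin n), 1, fun w => (Finset.abs_sum_le_sum_abs _ _).trans ?_⟩
  gcongr; split_ifs <;> simp

lemma cntAt_bdd (a r : ℝ) {k : ℕ} (T : Fin k → Fin k → Prop) {n : ℕ} (i : Fin n) :
    ∃ C, ∀ w : Fin n → ℂ × ℝ, |cntAt a r T i w| ≤ C := by
  refine ⟨∑ s : Finset (Fin n), 1, fun w => (Finset.abs_sum_le_sum_abs _ _).trans ?_⟩
  gcongr; split_ifs <;> simp

lemma good_update (a r : ℝ) {k : ℕ} (T : Fin k → Fin k → Prop) {n : ℕ} (i : Fin n)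
    (w : Fin n → ℂ × ℝ) (e : ℂ × ℝ) (s : Finset (Fin n)) (hi : i ∉ s) :
    good a r T (Function.update w i e) s ↔ good a r T w s := by
  unfold good
  refine exists_congr fun g => and_congr_right fun h => forall_congr' fun p => forall_congr' fun q => ?_
  have hne : ∀ p, g p ≠ i := fun p hp => hi (by rw [← h, ← hp]; simp)
  unfold arc
  simp [Function.update_of_ne (hne p), Function.update_of_ne (hne q)]

open Classical in
lemma cnt_update (a r : ℝ) {k : ℕ} (T : Fin k → Fin k → Prop) {n : ℕ} (i : Fin n)
    (w : Fin n → ℂ × ℝ) (e : ℂ × ℝ) :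
    cnt a r T (Function.update w i e) - cntAt a r T i (Function.update w i e) =
      cnt a r T w - cntAt a r T i w := by
  unfold cnt cntAt
  rw [← Finset.sum_sub_distrib, ← Finset.sum_sub_distrib]
  refine Finset.sum_congr rfl fun s _ => ?_
  by_cases hi : i ∈ s
  · have h1 : ∀ v, (i ∈ s ∧ good a r T v s) ↔ good a r T v s := fun v => by simp [hi]
    rw [if_congr (h1 _) rfl rfl, if_congr (h1 w) rfl rfl, sub_self, sub_self]
  · have h1 : ∀ v, ¬ (i ∈ s ∧ good a r T v s) := fun v h => hi h.1
    rw [if_neg (h1 _), if_neg (h1 _), if_congr (good_update a r T i w e s hi) rfl rfl]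

lemma sector_dist {a r : ℝ} {k n : ℕ} (T : Fin k → Fin k → Prop)
    (hT : (SimpleGraph.fromRel T).Connected) (hr : 0 ≤ r) (x : Fin n → ℂ) (y : Fin n → ℝ)
    (g : Fin k → Fin n) (h : ∀ i j, T i j → arc a r x y (g i) (g j)) (i j : Fin k) :
    ‖x (g i) - x (g j)‖ ≤ k * r := by
  have step : ∀ i j, (SimpleGraph.fromRel T).Adj i j → ‖x (g i) - x (g j)‖ ≤ r := by
    intro i j hij
    rw [SimpleGraph.fromRel_adj] at hij
    rcases hij.2 with h1 | h1
    · rw [norm_sub_rev]; exact (h i j h1).2.1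
    · exact (h j i h1).2.1
  have walk : ∀ i j (p : (SimpleGraph.fromRel T).Walk i j), ‖x (g i) - x (g j)‖ ≤ p.length * r := by
    intro i j p
    induction p with
    | nil => simp
    | cons hadj p ih =>
      rw [SimpleGraph.Walk.length_cons]
      push_cast
      have := norm_sub_le_norm_sub_add_norm_sub (x (g _)) (x (g _)) (x (g _)) |>.trans
        (add_le_add (step _ _ hadj) ih)
      linarith
  obtain ⟨p, hp⟩ := hT.exists_isPath i j
  have h1 := hp.length_lt
  rw [Fintype.card_fin] at h1
  refine (walk i j p).trans ?_
  gcongr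

lemma good_dist {a r : ℝ} {k n : ℕ} (T : Fin k → Fin k → Prop)
    (hT : (SimpleGraph.fromRel T).Connected) (hr : 0 ≤ r) (w : Fin n → ℂ × ℝ)
    (s : Finset (Fin n)) (h : good a r T w s) : s.card = k ∧
    ∀ i ∈ s, ∀ j ∈ s, ‖(w i).1 - (w j).1‖ ≤ k * r := by
  obtain ⟨g, rfl, h⟩ := h
  refine ⟨by simp, ?_⟩
  simp only [Finset.mem_map, Finset.mem_univ, true_and, forall_exists_index, forall_apply_eq_imp_iff]
  exact fun i j => sector_dist T hT hr (fun i => (w i).1) (fun i => (w i).2) g (fun i j => (h i j).1) i j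

open Classical in
def nbr {n : ℕ} (ρ : ℝ) (i : Fin (n + 1)) (w : Fin (n + 1) → ℂ × ℝ) : Finset (Fin n) :=
  Finset.univ.filter fun l => ‖(w (i.succAbove l)).1 - (w i).1‖ ≤ ρ

open Classical in
lemma cntAt_le {a r : ℝ} {m n : ℕ} (T : Fin (m + 1) → Fin (m + 1) → Prop)
    (hT : (SimpleGraph.fromRel T).Connected) (hr : 0 ≤ r) (i : Fin (n + 1))
    (w : Fin (n + 1) → ℂ × ℝ) :
    cntAt a r T i w ≤ ((nbr ((m + 1 : ℕ) * r) i w).card.choose m : ℕ) := by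
  unfold cntAt
  rw [Finset.sum_boole, ← Finset.card_powersetCard]
  norm_cast
  refine Finset.card_le_card_of_injOn (fun s => Finset.univ.filter fun l => i.succAbove l ∈ s) ?_ ?_
  · intro s hs
    simp only [Finset.coe_filter, Finset.mem_univ, true_and, mem_ofPred_eq] at hs
    obtain ⟨hc, hd⟩ := good_dist T hT hr w s hs.2
    simp only [Finset.mem_coe, Finset.mem_powersetCard]
    constructor
    · intro l hl
      simp only [Finset.mem_filter, Finset.mem_univ, true_and] at hl
      simp only [nbr, Finset.mem_filter, Finset.mem_univ, true_and]
      exact hd _ hl _ hs.1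
    · have : (Finset.univ.filter fun l => i.succAbove l ∈ s).map i.succAboveEmb = s.erase i := by
        ext j
        simp only [Finset.mem_map, Finset.mem_filter, Finset.mem_univ, true_and,
          Fin.coe_succAboveEmb, Finset.mem_erase]
        constructor
        · rintro ⟨l, hl, rfl⟩
          exact ⟨Fin.succAbove_ne i l, hl⟩
        · rintro ⟨h1, h2⟩
          obtain ⟨l, rfl⟩ := Fin.exists_succAbove_eq h1
          exact ⟨l, h2, rfl⟩
      rw [← Finset.card_map i.succAboveEmb, this, Finset.card_erase_of_mem hs.1, hc]; simp
  · intro s hs t ht hst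
    simp only [Finset.coe_filter, Finset.mem_univ, true_and, mem_ofPred_eq] at hs ht
    ext j
    by_cases h : j = i
    · subst h; simp [hs.1, ht.1]
    · obtain ⟨l, rfl⟩ := Fin.exists_succAbove_eq h
      have := Finset.ext_iff.mp hst l
      simpa using this

lemma cntAt_nonneg (a r : ℝ) {k : ℕ} (T : Fin k → Fin k → Prop) {n : ℕ} (i : Fin n)
    (w : Fin n → ℂ × ℝ) : 0 ≤ cntAt a r T i w := by
  unfold cntAt
  exact Finset.sum_nonneg fun s _ => by split_ifs <;> simp

lemma choose_pow_le (m q : ℕ) (hq : 1 ≤ q) : ∃ K : ℕ, ∀ B : ℕ, B.choose m ^ q ≤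
    K * (B.choose m + B.choose (q * m)) := by
  refine ⟨(2 ^ (2 * (q * m))) ^ q + 2 ^ (q * m) * (q * m).factorial, fun B => ?_⟩
  rcases lt_or_ge B (2 * (q * m)) with h | h
  · have h1 : B.choose m ≤ 2 ^ (2 * (q * m)) :=
      (Nat.choose_le_two_pow _ _).trans (Nat.pow_le_pow_right (by norm_num) h.le)
    rcases Nat.eq_zero_or_pos (B.choose m) with h0 | h0
    · rw [h0, zero_pow (by omega)]; omega
    · calc B.choose m ^ q ≤ (2 ^ (2 * (q * m))) ^ q * 1 := by
            rw [mul_one]; exact Nat.pow_le_pow_left h1 q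
        _ ≤ _ := Nat.mul_le_mul (Nat.le_add_right _ _) (by omega)
  · have h1 : B ^ (q * m) ≤ 2 ^ (q * m) * ((q * m).factorial * B.choose (q * m)) := by
      rw [← Nat.descFactorial_eq_factorial_mul_choose]
      calc B ^ (q * m) ≤ (2 * (B + 1 - q * m)) ^ (q * m) := Nat.pow_le_pow_left (by omega) _
        _ = 2 ^ (q * m) * (B + 1 - q * m) ^ (q * m) := Nat.mul_pow _ _ _
        _ ≤ _ := Nat.mul_le_mul_left _ (Nat.pow_sub_le_descFactorial _ _)
    calc B.choose m ^ q ≤ (B ^ m) ^ q := Nat.pow_le_pow_left (Nat.choose_le_pow _ _) q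
      _ = B ^ (q * m) := by rw [← pow_mul, mul_comm]
      _ ≤ _ := h1
      _ = (2 ^ (q * m) * (q * m).factorial) * B.choose (q * m) := by ring
      _ ≤ _ := Nat.mul_le_mul (Nat.le_add_left _ _) (Nat.le_add_left _ _)

section
variable (μ : Measure (ℂ × ℝ)) [IsProbabilityMeasure μ]

lemma integral_insert {n : ℕ} (i : Fin (n + 1)) (F : (Fin (n + 1) → ℂ × ℝ) → ℝ) (hF : Measurable F)
    (hb : ∃ C, ∀ x, |F x| ≤ C) :
    ∫ x, F x ∂(Measure.pi fun _ => μ) =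
      ∫ t, ∫ y, F (i.insertNth t y) ∂(Measure.pi fun _ : Fin n => μ) ∂μ := by
  have h := (measurePreserving_piFinSuccAbove (fun _ : Fin (n + 1) => μ) i).symm
  rw [← h.integral_comp (MeasurableEquiv.measurableEmbedding _)]
  rw [integral_prod]
  · rfl
  · exact bint (hF.comp (MeasurableEquiv.measurable _)) ⟨hb.choose, fun x => hb.choose_spec _⟩

open Classical in
lemma choose_nbr_eq {n : ℕ} (ρ : ℝ) (i : Fin (n + 1)) (j : ℕ) (w : Fin (n + 1) → ℂ × ℝ) :
    (((nbr ρ i w).card.choose j : ℕ) : ℝ) = ∑ J ∈ Finset.powersetCard j (Finset.univ : Finset (Fin n)),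
      ∏ l, if l ∈ J then (if ‖(w (i.succAbove l)).1 - (w i).1‖ ≤ ρ then (1:ℝ) else 0) else 1 := by
  rw [← Finset.card_powersetCard]
  have : Finset.powersetCard j (nbr ρ i w) =
      (Finset.powersetCard j (Finset.univ : Finset (Fin n))).filter fun J => J ⊆ nbr ρ i w := by
    ext J; simp [Finset.mem_powersetCard, and_comm]
  rw [this, ← Finset.sum_boole]
  refine Finset.sum_congr rfl fun J _ => ?_
  rw [Finset.prod_ite]
  simp only [Finset.prod_const_one, mul_one, Finset.filter_mem_eq_inter, Finset.univ_inter]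
  rw [Finset.prod_boole]
  congr 1
  simp [nbr, Finset.subset_iff]

open Classical in
lemma choose_nbr_meas {n : ℕ} (ρ : ℝ) (i : Fin (n + 1)) (j : ℕ) :
    Measurable (fun w => (((nbr ρ i w).card.choose j : ℕ) : ℝ)) := by
  simp_rw [choose_nbr_eq]
  refine Finset.measurable_fun_sum _ fun J _ => Finset.measurable_fun_prod _ fun l _ => ?_
  by_cases h : l ∈ J
  · simp only [h, if_true]
    exact Measurable.ite (measurableSet_le (by fun_prop) measurable_const) measurable_const measurable_const
  · simp [h]

lemma choose_nbr_bdd {n : ℕ} (ρ : ℝ) (i : Fin (n + 1)) (j : ℕ) :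
    ∃ C, ∀ w, |(((nbr ρ i w).card.choose j : ℕ) : ℝ)| ≤ C := by
  refine ⟨((n.choose j : ℕ) : ℝ), fun w => ?_⟩
  rw [abs_of_nonneg (by positivity)]
  norm_cast
  refine Nat.choose_le_choose _ ?_
  simpa using Finset.card_le_univ (nbr ρ i w)

open Classical in
lemma integral_choose_nbr {n : ℕ} (ρ p : ℝ) 
    (hp : ∀ t : ℂ, μ.real {e | ‖e.1 - t‖ ≤ ρ} ≤ p) (i : Fin (n + 1)) (j : ℕ) :
    ∫ w, (((nbr ρ i w).card.choose j : ℕ) : ℝ) ∂(Measure.pi fun _ => μ) ≤ (n * p) ^ j := by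
  have hp0 : 0 ≤ p := measureReal_nonneg.trans (hp 0)
  rw [integral_insert μ i _ (choose_nbr_meas ρ i j) (choose_nbr_bdd ρ i j)]
  have hin : ∀ t : ℂ × ℝ, ∫ y, (((nbr ρ i (i.insertNth t y)).card.choose j : ℕ) : ℝ)
      ∂(Measure.pi fun _ : Fin n => μ) ≤ (n * p) ^ j := by
    intro t
    simp_rw [choose_nbr_eq, Fin.insertNth_apply_succAbove, Fin.insertNth_apply_same]
    have hm : ∀ (J : Finset (Fin n)) (l : Fin n), Measurable (fun e : ℂ × ℝ => 
      if l ∈ J then (if ‖e.1 - t.1‖ ≤ ρ then (1:ℝ) else 0) else 1) := by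
      intro J l
      by_cases h : l ∈ J
      · simp only [h, if_true]
        exact Measurable.ite (measurableSet_le (by fun_prop) measurable_const) measurable_const measurable_const
      · simp [h]
    rw [integral_finsetSum]
    · calc _ ≤ ∑ J ∈ Finset.powersetCard j (Finset.univ : Finset (Fin n)), p ^ j := by
            refine Finset.sum_le_sum fun J hJ => ?_
            rw [Finset.mem_powersetCard] at hJ
            rw [integral_fintype_prod_eq_prod (fun l (e : ℂ × ℝ) =>
              if l ∈ J then (if ‖e.1 - t.1‖ ≤ ρ then (1:ℝ) else 0) else 1)]
            have : ∀ l, ∫ e, (if l ∈ J then (if ‖e.1 - t.1‖ ≤ ρ then (1:ℝ) else 0) else 1) ∂μ =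
                if l ∈ J then μ.real {e | ‖e.1 - t.1‖ ≤ ρ} else 1 := by
              intro l
              by_cases h : l ∈ J
              · simp only [h, if_true]
                have hms : MeasurableSet {e : ℂ × ℝ | ‖e.1 - t.1‖ ≤ ρ} :=
                  measurableSet_le (by fun_prop) measurable_const
                rw [← integral_indicator_one hms]
                rfl
              · simp [h]
            simp_rw [this]
            rw [Finset.prod_ite]
            simp only [Finset.prod_const_one, mul_one, Finset.filter_mem_eq_inter, Finset.univ_inter,
              Finset.prod_const, hJ.2]
            exact pow_le_pow_left₀ measureReal_nonneg (hp _) _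
        _ = (n.choose j : ℝ) * p ^ j := by
            rw [Finset.sum_const, Finset.card_powersetCard]; simp
        _ ≤ (n ^ j : ℝ) * p ^ j := by
            gcongr
            exact_mod_cast Nat.choose_le_pow _ _
        _ = _ := by rw [mul_pow]
    · intro J _
      refine bint ?_ ⟨1, fun y => ?_⟩
      · exact Finset.measurable_fun_prod _ fun l _ => (hm J l).comp (measurable_pi_apply l)
      · rw [Finset.abs_prod]
        refine Finset.prod_le_one (fun _ _ => abs_nonneg _) fun l _ => ?_
        split_ifs <;> simp
  calc _ ≤ ∫ _t, (n * p) ^ j ∂μ := by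
        refine integral_mono_of_nonneg (Eventually.of_forall fun t => ?_) (integrable_const _)
          (Eventually.of_forall hin)
        exact integral_nonneg fun _ => by positivity
    _ = _ := by simp

lemma integral_cntAt_pow (m q : ℕ) (hq : 1 ≤ q) : ∃ K : ℝ, 0 ≤ K ∧
    ∀ (a r p : ℝ) (_ : 0 ≤ a) (_ : 0 ≤ r) (T : Fin (m + 1) → Fin (m + 1) → Prop)
      (_ : (SimpleGraph.fromRel T).Connected)
      (_ : ∀ t : ℂ, μ.real {e | ‖e.1 - t‖ ≤ (m + 1 : ℕ) * r} ≤ p) (n : ℕ) (i : Fin n),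
    ∫ w, cntAt a r T i w ^ q ∂(Measure.pi fun _ => μ) ≤ K * ((n * p) ^ m + (n * p) ^ (q * m)) := by
  obtain ⟨K, hK⟩ := choose_pow_le m q hq
  refine ⟨K, by positivity, fun a r p ha hr T hT hp n i => ?_⟩
  obtain ⟨n, rfl⟩ : ∃ n', n = n' + 1 := ⟨n - 1, by have := i.isLt; omega⟩
  have hp0 : 0 ≤ p := measureReal_nonneg.trans (hp 0)
  set ρ : ℝ := (m + 1 : ℕ) * r
  have j1 := bint (μ := Measure.pi fun _ => μ) (choose_nbr_meas ρ i m) (choose_nbr_bdd ρ i m)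
  have j2 := bint (μ := Measure.pi fun _ => μ) (choose_nbr_meas ρ i (q * m)) (choose_nbr_bdd ρ i (q * m))
  calc _ ≤ ∫ w, (K : ℝ) * ((((nbr ρ i w).card.choose m : ℕ) : ℝ) +
          (((nbr ρ i w).card.choose (q * m) : ℕ) : ℝ)) ∂(Measure.pi fun _ => μ) := by
        refine integral_mono (bint ((cntAt_meas a r ha T i).pow_const _) (bpow (cntAt_bdd a r T i) _))
          ((j1.add j2).const_mul _) fun w => ?_
        refine (pow_le_pow_left₀ (cntAt_nonneg _ _ _ _ _) (cntAt_le T hT hr i w) q).trans ?_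
        exact_mod_cast hK _
    _ = K * (∫ w, (((nbr ρ i w).card.choose m : ℕ) : ℝ) ∂(Measure.pi fun _ => μ) +
          ∫ w, (((nbr ρ i w).card.choose (q * m) : ℕ) : ℝ) ∂(Measure.pi fun _ => μ)) := by
        rw [integral_const_mul, integral_add j1 j2]
    _ ≤ K * ((n * p) ^ m + (n * p) ^ (q * m)) := by
        gcongr
        · exact integral_choose_nbr μ ρ p hp i m
        · exact integral_choose_nbr μ ρ p hp i (q * m)
    _ ≤ _ := by gcongr <;> simp

lemma integral_cnt_center (m q : ℕ) : ∃ K : ℝ, 0 ≤ K ∧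
    ∀ (a r p : ℝ) (_ : 0 ≤ a) (_ : 0 ≤ r) (T : Fin (m + 1) → Fin (m + 1) → Prop)
      (_ : (SimpleGraph.fromRel T).Connected)
      (_ : ∀ t : ℂ, μ.real {e | ‖e.1 - t‖ ≤ (m + 1 : ℕ) * r} ≤ p) (n : ℕ) (_ : 1 ≤ n),
    ∫ w : Fin n → ℂ × ℝ, (cnt a r T w - ∫ z : Fin n → ℂ × ℝ, cnt a r T z ∂(Measure.pi fun _ => μ)) ^ (2 * (q + 1))
      ∂(Measure.pi fun _ => μ) ≤ K * n ^ (q + 1) * ((n * p) ^ m + (n * p) ^ (2 * (q + 1) * m)) := by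
  obtain ⟨K1, hK1, h1⟩ := point_ineq q
  obtain ⟨K2, hK2, h2⟩ := integral_cntAt_pow μ m (2 * (q + 1)) (by omega)
  refine ⟨Real.exp 1 * (K1 * (4 ^ (q + 1) * K2)), by positivity, fun a r p ha hr T hT hp n hn => ?_⟩
  have hp0 : 0 ≤ p := measureReal_nonneg.trans (hp 0)
  have hn' : (1:ℝ) ≤ n := by exact_mod_cast hn
  have := moment_ineq μ q K1 n hK1 hn' (h1 n hn') (K2 * ((n * p) ^ m + (n * p) ^ (2 * (q + 1) * m)))
    (by positivity) n (cnt a r T) (cntAt a r T) (cnt_meas a r ha T) (cnt_bdd a r T)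
    (cntAt_meas a r ha T) (cntAt_bdd a r T) (cnt_update a r T) (h2 a r p ha hr T hT hp n)
  refine this.trans ?_
  have he : (1 + 1 / (n:ℝ)) ^ n ≤ Real.exp 1 := by
    have h3 : 1 + 1 / (n:ℝ) ≤ Real.exp (1 / n) := by linarith [Real.add_one_le_exp (1 / (n:ℝ))]
    calc _ ≤ Real.exp (1 / n) ^ n := by gcongr
      _ = Real.exp 1 := by
        rw [← Real.exp_nat_mul]; congr 1; field_simp
  calc _ ≤ Real.exp 1 * n * (K1 * n ^ q * (4 ^ (q + 1) * (K2 * ((n * p) ^ m + (n * p) ^ (2 * (q + 1) * m))))) := by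
        gcongr
    _ = _ := by ring
end


lemma law_comp {Ω : Type*} [MeasurableSpace Ω] {P : Measure Ω} {ι : Type*} {Z : ι → Ω → ℂ × ℝ}
    (hZm : ∀ i, Measurable (Z i)) (hZi : iIndepFun Z P) {μ : Measure (ℂ × ℝ)}
    (hZd : ∀ i, Measure.map (Z i) P = μ) {j : ℕ} (e : Fin j → ι) (he : Function.Injective e) :
    Measure.map (fun ω i => Z (e i) ω) P = Measure.pi (fun _ : Fin j => μ) := by
  have := (hZi.precomp he).map_fun_eq_pi_map (fun i => (hZm (e i)).aemeasurable)
  rw [this]; congr 1; funext i; exact hZd _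

lemma good_iff_isoT (a r : ℝ) {k : ℕ} (T : Fin k → Fin k → Prop) {n : ℕ} (w : Fin n → ℂ × ℝ)
    (s : Finset (Fin n)) (h : s.card = k) :
    good a r T w s ↔ isoT a r T (fun i => (w (s.orderEmbOfFin h i)).1)
      (fun i => (w (s.orderEmbOfFin h i)).2) := by
  have harc : ∀ i j : Fin k, arc a r (fun i => (w (s.orderEmbOfFin h i)).1)
      (fun i => (w (s.orderEmbOfFin h i)).2) i j ↔
      arc a r (fun i => (w i).1) (fun i => (w i).2) (s.orderEmbOfFin h i) (s.orderEmbOfFin h j) := by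
    intro i j; simp [arc]
  constructor
  · rintro ⟨g, hg, hT⟩
    have hmem : ∀ i, g i ∈ s := fun i => by rw [← hg]; simp
    let φ : Fin k → Fin k := fun i => (s.orderIsoOfFin h).symm ⟨g i, hmem i⟩
    have hφ : ∀ i, s.orderEmbOfFin h (φ i) = g i := fun i => by
      rw [← Finset.coe_orderIsoOfFin_apply]; simp [φ]
    have hinj : Function.Injective φ := fun i j hij => g.injective (by rw [← hφ, ← hφ, hij])
    refine ⟨Equiv.ofBijective φ (Finite.injective_iff_bijective.1 hinj), fun i j => ?_⟩
    rw [harc]; simp only [Equiv.ofBijective_apply, hφ]; exact hT i j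
  · rintro ⟨e, he⟩
    refine ⟨e.toEmbedding.trans (s.orderEmbOfFin h).toEmbedding, ?_, fun i j => ?_⟩
    · rw [← Finset.map_map]
      rw [Finset.map_univ_equiv]
      ext x
      have := Finset.range_orderEmbOfFin s h
      simp only [Finset.mem_map, Finset.mem_univ, true_and]
      exact Set.ext_iff.1 this x
    · rw [he, harc]; rfl

open Classical in
lemma integral_cnt (μ : Measure (ℂ × ℝ)) [IsProbabilityMeasure μ] (a r : ℝ) (ha : 0 ≤ a) {k : ℕ}
    (T : Fin k → Fin k → Prop) (n : ℕ) :
    ∫ w : Fin n → ℂ × ℝ, cnt a r T w ∂(Measure.pi fun _ => μ) = n.choose k *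
      (Measure.pi fun _ : Fin k => μ).real {w | isoT a r T (fun i => (w i).1) (fun i => (w i).2)} := by
  unfold cnt
  rw [integral_finsetSum]
  · have : ∀ s : Finset (Fin n), (∫ w : Fin n → ℂ × ℝ, (if good a r T w s then (1:ℝ) else 0) ∂(Measure.pi fun _ => μ)) = if s ∈ Finset.powersetCard k Finset.univ then
      (Measure.pi fun _ : Fin k => μ).real {w | isoT a r T (fun i => (w i).1) (fun i => (w i).2)} else 0 := by
      intro s
      simp only [Finset.mem_powersetCard_univ]
      split_ifs with h
      · have hl := law_comp (P := Measure.pi fun _ : Fin n => μ) (Z := fun i w => w i)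
          (fun i => measurable_pi_apply i)
          (iIndepFun_pi (X := fun _ => id) (fun _ => aemeasurable_id))
          (fun i => (measurePreserving_eval (fun _ => μ) i).map_eq) (s.orderEmbOfFin h)
          (s.orderEmbOfFin h).injective
        rw [← hl, map_measureReal_apply (by fun_prop) (meas_isoT a r ha T), ← integral_indicator_one
          ((meas_isoT a r ha T).preimage (by fun_prop))]
        congr 1
        ext w
        simp only [Set.indicator, good_iff_isoT a r T w s h, Set.mem_preimage, Set.mem_ofPred_eq]
        rfl
      · have : ∀ w : Fin n → ℂ × ℝ, ¬ good a r T w s := by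
          rintro w ⟨g, rfl, -⟩; simp at h
        simp [this]
    simp_rw [this]
    rw [← Finset.sum_filter, Finset.sum_const]
    simp
  · intro s _
    refine bint (Measurable.ite (meas_good a r ha T s) measurable_const measurable_const) ⟨1, fun w => ?_⟩
    split_ifs <;> simp

lemma lintegral_pi_prod {α : Type*} [MeasurableSpace α] (ν : Measure α) [SigmaFinite ν] :
    ∀ (n : ℕ) (G : Fin n → α → ENNReal) (_ : ∀ i, Measurable (G i)),
    ∫⁻ w, ∏ i, G i (w i) ∂(Measure.pi fun _ : Fin n => ν) = ∏ i, ∫⁻ x, G i x ∂ν := by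
  intro n
  induction n with
  | zero => intro G hG; simp
  | succ n ih =>
    intro G hG
    have h := (measurePreserving_piFinSuccAbove (fun _ : Fin (n + 1) => ν) 0).symm
    have m1 : Measurable fun w : Fin (n + 1) → α => ∏ i, G i (w i) :=
      Finset.measurable_fun_prod _ fun i _ => (hG i).comp (measurable_pi_apply i)
    have m2 : Measurable fun w : Fin n → α => ∏ i : Fin n, G i.succ (w i) :=
      Finset.measurable_fun_prod _ fun i _ => (hG i.succ).comp (measurable_pi_apply i)
    rw [← h.lintegral_comp m1, Fin.prod_univ_succ, ← ih _ (fun i => hG i.succ),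
      ← lintegral_prod_mul (hG 0).aemeasurable m2.aemeasurable]
    refine lintegral_congr fun p => ?_
    rw [Fin.prod_univ_succ]
    simp [MeasurableEquiv.piFinSuccAbove]

lemma pi_withDensity {α : Type*} [MeasurableSpace α] (ν : Measure α) [SigmaFinite ν] (n : ℕ)
    (G : α → ENNReal) (hG : Measurable G) [SigmaFinite (ν.withDensity G)] :
    (Measure.pi fun _ : Fin n => ν.withDensity G) =
      (Measure.pi fun _ : Fin n => ν).withDensity (fun w => ∏ i, G (w i)) := by
  refine Measure.pi_eq fun s hs => ?_
  rw [withDensity_apply _ (MeasurableSet.univ_pi hs), ← lintegral_indicator (MeasurableSet.univ_pi hs)]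
  have := lintegral_pi_prod ν n (fun i => (s i).indicator G) (fun i => hG.indicator (hs i))
  simp_rw [withDensity_apply _ (hs _), ← lintegral_indicator (hs _)]
  rw [← this]
  refine lintegral_congr fun w => ?_
  by_cases h : w ∈ univ.pi s
  · rw [indicator_of_mem h]
    exact Finset.prod_congr rfl fun i _ => (indicator_of_mem (h i trivial) G).symm
  · rw [indicator_of_notMem h]
    simp only [Set.mem_pi, Set.mem_univ, true_imp_iff, not_forall] at h
    obtain ⟨i, hi⟩ := h
    exact (Finset.prod_eq_zero (Finset.mem_univ i) (indicator_of_notMem hi G)).symm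



lemma sector_scale (a r : ℝ) (hr : 0 < r) (x0 u v : ℂ) (y : ℝ) :
    x0 + r * v ∈ sector a (x0 + r * u) y r ↔ v ∈ sector a u y 1 := by
  have h1 : x0 + r * v - (x0 + r * u) = r * (v - u) := by ring
  have h2 : ‖r * (v - u)‖ = r * ‖v - u‖ := by
    rw [norm_mul, Complex.norm_real, Real.norm_of_nonneg hr.le]
  have hr' : (r : ℂ) ≠ 0 := by exact_mod_cast hr.ne'
  unfold sector
  simp only [Set.mem_ofPred_eq, h1, h2]
  refine and_congr ?_ (exists_congr fun t => and_congr_right fun _ => and_congr_right fun _ => ?_)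
  · rw [mul_le_iff_le_one_right hr]
  · push_cast
    rw [mul_assoc, mul_right_inj' hr']

lemma isoT_scale (a r : ℝ) (hr : 0 < r) {k : ℕ} (T : Fin k → Fin k → Prop) (x0 : ℂ) (u : Fin k → ℂ)
    (y : Fin k → ℝ) : isoT a r T (fun i => x0 + r * u i) y ↔ isoT a 1 T u y := by
  unfold isoT arc
  simp only [sector_scale a r hr]

lemma isoT_meas (a r : ℝ) (ha : 0 ≤ a) {k : ℕ} (T : Fin k → Fin k → Prop) :
    MeasurableSet {p : (Fin k → ℂ) × (Fin k → ℝ) | isoT a r T p.1 p.2} :=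
  (meas_isoT a r ha T).preimage (f := fun p : (Fin k → ℂ) × (Fin k → ℝ) => fun i => (p.1 i, p.2 i))
    (by fun_prop)

lemma isoT_measx (a r : ℝ) (ha : 0 ≤ a) {k : ℕ} (T : Fin k → Fin k → Prop) (y : Fin k → ℝ) :
    MeasurableSet {x : Fin k → ℂ | isoT a r T x y} :=
  (isoT_meas a r ha T).preimage (f := fun x : (Fin k → ℂ) => (x, y)) (by fun_prop)

open Classical in
/-- extended-real indicator of the limiting configuration set -/
def hE (a : ℝ) {m : ℕ} (T : Fin (m + 1) → Fin (m + 1) → Prop) (y : Fin (m + 1) → ℝ)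
    (z : Fin m → ℂ) : ENNReal :=
  if isoT a 1 T (Fin.cons 0 z) y then 1 else 0

lemma hE_meas (a : ℝ) (ha : 0 ≤ a) {m : ℕ} (T : Fin (m + 1) → Fin (m + 1) → Prop) :
    Measurable fun p : (Fin (m + 1) → ℝ) × (Fin m → ℂ) => hE a T p.1 p.2 := by
  unfold hE
  refine Measurable.ite ?_ measurable_const measurable_const
  refine (isoT_meas a 1 ha T).preimage
    (f := fun p : (Fin (m + 1) → ℝ) × (Fin m → ℂ) => ((Fin.cons 0 p.2 : Fin (m + 1) → ℂ), p.1)) ?_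
  refine Measurable.prodMk ?_ measurable_fst
  refine measurable_pi_iff.2 fun i => ?_
  refine Fin.cases ?_ (fun i => ?_) i
  · simp
  · simp; fun_prop

lemma hE_meas1 (a : ℝ) (ha : 0 ≤ a) {m : ℕ} (T : Fin (m + 1) → Fin (m + 1) → Prop)
    (y : Fin (m + 1) → ℝ) : Measurable (hE a T y) :=
  Measurable.of_uncurry_left (f := hE a T) (hE_meas a ha T)

lemma lintegral_scale {m : ℕ} (F : (Fin m → ℂ) → ENNReal) (hF : Measurable F) (r : ℝ) (hr : 0 < r) :
    ∫⁻ v, F v = ENNReal.ofReal (r ^ (2 * m)) * ∫⁻ z, F (r • z) := by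
  have h := Measure.map_addHaar_smul (volume : Measure (Fin m → ℂ)) hr.ne'
  have hd : Module.finrank ℝ (Fin m → ℂ) = 2 * m := by
    rw [Module.finrank_pi_fintype]; simp [mul_comm]
  rw [hd, abs_of_pos (by positivity)] at h
  rw [← lintegral_map hF (by fun_prop : Measurable fun z : Fin m → ℂ => r • z), h,
    lintegral_smul_measure, smul_eq_mul, ← mul_assoc, ← ENNReal.ofReal_mul (by positivity),
    mul_inv_cancel₀ (by positivity), ENNReal.ofReal_one, one_mul]

open Classical in
lemma theta_y (g : ℂ → ENNReal) (hg : Measurable g) [SigmaFinite (volume.withDensity g)]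
    (a r : ℝ) (ha : 0 ≤ a) (hr : 0 < r) {m : ℕ} (T : Fin (m + 1) → Fin (m + 1) → Prop)
    (y : Fin (m + 1) → ℝ) :
    (Measure.pi fun _ : Fin (m + 1) => volume.withDensity g) {x | isoT a r T x y} =
      ENNReal.ofReal (r ^ (2 * m)) * ∫⁻ z : Fin m → ℂ, hE a T y z *
        ∫⁻ x : ℂ, g x * ∏ i, g (x + r * z i) := by
  have hE1 : Measurable (hE a T y) := hE_meas1 a ha T y
  rw [pi_withDensity _ _ _ hg, withDensity_apply _ (isoT_measx a r ha T y),
    ← lintegral_indicator (isoT_measx a r ha T y)]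
  have hpm : Measurable fun w : Fin (m + 1) → ℂ => ∏ i, g (w i) :=
    Finset.measurable_fun_prod _ fun i _ => hg.comp (measurable_pi_apply i)
  have hm : Measurable (indicator {x : Fin (m + 1) → ℂ | isoT a r T x y} fun w => ∏ i, g (w i)) :=
    hpm.indicator (isoT_measx a r ha T y)
  have h := (measurePreserving_piFinSuccAbove (fun _ : Fin (m + 1) => (volume : Measure ℂ)) 0).symm
  rw [← h.lintegral_comp hm]
  rw [lintegral_prod (fun p => {x | isoT a r T x y}.indicator (fun w => ∏ i, g (w i))
        ((MeasurableEquiv.piFinSuccAbove (fun x => ℂ) 0).symm p))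
        (hm.comp (MeasurableEquiv.piFinSuccAbove (fun x => ℂ) 0).symm.measurable).aemeasurable]
  have hpm2 : Measurable fun p : ℂ × (Fin m → ℂ) => g p.1 * ∏ i, g (p.1 + r * p.2 i) := by
    refine (hg.comp measurable_fst).mul (Finset.measurable_fun_prod _ fun i _ => hg.comp (by fun_prop))
  have step : ∀ x0 : ℂ, ∫⁻ v : Fin m → ℂ, (indicator {x : Fin (m + 1) → ℂ | isoT a r T x y}
      fun w => ∏ i, g (w i)) ((MeasurableEquiv.piFinSuccAbove (fun _ => ℂ) 0).symm (x0, v))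
      ∂(Measure.pi fun _ => volume)
      = ENNReal.ofReal (r ^ (2 * m)) * ∫⁻ z : Fin m → ℂ, hE a T y z * (g x0 * ∏ i, g (x0 + r * z i)) := by
    intro x0
    have hmm := (hm.comp (MeasurableEquiv.piFinSuccAbove (fun _ => ℂ) 0).symm.measurable).comp
      (measurable_prodMk_left (x := x0))
    rw [← volume_pi, ← lintegral_add_left_eq_self _ (fun _ => x0), lintegral_scale _ _ r hr]
    · congr 1
      refine lintegral_congr fun z => ?_
      have : (MeasurableEquiv.piFinSuccAbove (fun _ : Fin (m + 1) => ℂ) 0).symm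
          (x0, (fun _ => x0) + r • z) = fun i => x0 + r * (Fin.cons 0 z : Fin (m + 1) → ℂ) i := by
        funext i
        refine Fin.cases ?_ (fun i => ?_) i <;> simp [MeasurableEquiv.piFinSuccAbove]
      rw [this]
      unfold hE
      rw [Set.indicator_apply]
      simp only [Set.mem_ofPred_eq, isoT_scale a r hr T]
      split_ifs
      · rw [Fin.prod_univ_succ]; simp
      · simp
    · exact hmm.comp (measurable_const_add _)
  rw [lintegral_congr step, lintegral_const_mul, lintegral_lintegral_swap]
  · congr 1
    refine lintegral_congr fun z => ?_
    rw [lintegral_const_mul]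
    exact hpm2.comp measurable_prodMk_right
  · exact ((hE1.comp measurable_snd).mul hpm2).aemeasurable
  · exact Measurable.lintegral_prod_right' ((hE1.comp measurable_snd).mul hpm2)

lemma theta_eq (g : ℂ → ENNReal) (hg : Measurable g) [SigmaFinite (volume.withDensity g)]
    (υ : Measure ℝ) [SigmaFinite υ]
    (a r : ℝ) (ha : 0 ≤ a) (hr : 0 < r) {m : ℕ} (T : Fin (m + 1) → Fin (m + 1) → Prop) :
    (Measure.pi fun _ : Fin (m + 1) => (volume.withDensity g).prod υ)
      {w | isoT a r T (fun i => (w i).1) (fun i => (w i).2)} =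
      ENNReal.ofReal (r ^ (2 * m)) * ∫⁻ y, (∫⁻ z : Fin m → ℂ, hE a T y z *
        ∫⁻ x : ℂ, g x * ∏ i, g (x + r * z i)) ∂(Measure.pi fun _ : Fin (m + 1) => υ) := by
  have h := measurePreserving_arrowProdEquivProdArrow ℂ ℝ (Fin (m + 1)) 
    (fun _ => volume.withDensity g) (fun _ => υ)
  have h2 := h.measure_preimage (isoT_meas a r ha T).nullMeasurableSet
  have h3 : (MeasurableEquiv.arrowProdEquivProdArrow ℂ ℝ (Fin (m + 1))) ⁻¹'
     {p : (Fin (m + 1) → ℂ) × (Fin (m + 1) → ℝ) | isoT a r T p.1 p.2} =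
     {w | isoT a r T (fun i => (w i).1) (fun i => (w i).2)} := rfl
  rw [h3] at h2
  rw [h2, Measure.prod_apply_symm (isoT_meas a r ha T)]
  have : ∀ y : Fin (m + 1) → ℝ, (fun x => (x, y)) ⁻¹'
    {p : (Fin (m + 1) → ℂ) × (Fin (m + 1) → ℝ) | isoT a r T p.1 p.2} = {x | isoT a r T x y} := fun y => rfl
  simp only [this, theta_y g hg a r ha hr T]
  rw [lintegral_const_mul]
  have hpm2 : Measurable fun p : (Fin m → ℂ) × ℂ => g p.2 * ∏ i, g (p.2 + r * p.1 i) := by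
    refine (hg.comp measurable_snd).mul (Finset.measurable_fun_prod _ fun i _ => hg.comp (by fun_prop))
  have h4 : Measurable fun z : Fin m → ℂ => ∫⁻ x : ℂ, g x * ∏ i, g (x + r * z i) :=
    Measurable.lintegral_prod_right' hpm2
  exact Measurable.lintegral_prod_right' (ν := volume) ((hE_meas a ha T).mul (h4.comp measurable_snd))



lemma phi_tendsto (f : ℂ → ℝ) (hf0 : ∀ x, 0 ≤ f x) (C : ℝ)
    (hfc : ∀ᵐ x : ℂ, ContinuousAt f x) (g : ℂ → ENNReal) (hg : Measurable g)
    (hgC : ∀ x, g x ≤ ENNReal.ofReal C)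
    (hgf : ∀ᵐ x, g x = ENNReal.ofReal (f x)) (hgi : ∫⁻ x, g x ≠ ⊤)
    (r : ℕ → ℝ) (hr0 : Tendsto r atTop (𝓝 0)) {m : ℕ} (z : Fin m → ℂ) :
    Tendsto (fun n => ∫⁻ x : ℂ, g x * ∏ i, g (x + r n * z i)) atTop
      (𝓝 (∫⁻ x, ENNReal.ofReal (f x ^ (m + 1)))) := by
  refine tendsto_lintegral_of_dominated_convergence (fun x => g x * ENNReal.ofReal C ^ m) ?_ ?_ ?_ ?_
  · intro n
    exact hg.mul (Finset.measurable_fun_prod _ fun i _ => hg.comp (by fun_prop))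
  · intro n
    refine Eventually.of_forall fun x => ?_
    dsimp only
    gcongr
    calc ∏ i, g (x + r n * z i) ≤ ∏ i : Fin m, ENNReal.ofReal C := by gcongr; exact hgC _
      _ = _ := by simp
  · rw [lintegral_mul_const _ hg]
    exact ENNReal.mul_ne_top hgi (by finiteness)
  · have h1 : ∀ᵐ x : ℂ, ∀ n i, g (x + r n * z i) = ENNReal.ofReal (f (x + r n * z i)) := by
      refine ae_all_iff.2 fun n => ae_all_iff.2 fun i => ?_
      exact (measurePreserving_add_right volume ((r n : ℂ) * z i)).quasiMeasurePreserving.ae hgf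
    filter_upwards [h1, hgf, hfc] with x h1 h2 h3
    have h4 : ∀ n, g x * ∏ i, g (x + r n * z i) = ENNReal.ofReal (f x * ∏ i, f (x + r n * z i)) := by
      intro n
      rw [ENNReal.ofReal_mul (hf0 _), ENNReal.ofReal_prod_of_nonneg (fun i _ => hf0 _), h2]
      simp only [h1]
    simp only [h4]
    refine ENNReal.tendsto_ofReal ?_
    have : f x ^ (m + 1) = f x * ∏ i : Fin m, f x := by simp [pow_succ, mul_comm]
    rw [this]
    refine tendsto_const_nhds.mul (tendsto_finsetProd _ fun i _ => h3.tendsto.comp ?_)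
    have : Tendsto (fun n => x + (r n : ℂ) * z i) atTop (𝓝 (x + ((0:ℝ):ℂ) * z i)) :=
      tendsto_const_nhds.add (((Complex.continuous_ofReal.tendsto 0).comp hr0).mul_const _)
    simpa using this

lemma phi_le (C : ENNReal) (g : ℂ → ENNReal) (hg : Measurable g)
    (hgC : ∀ x, g x ≤ C) (hgi : ∫⁻ x, g x = 1) (r : ℝ) {m : ℕ} (z : Fin m → ℂ) :
    ∫⁻ x : ℂ, g x * ∏ i, g (x + r * z i) ≤ C ^ m := by
  calc _ ≤ ∫⁻ x, g x * C ^ m := by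
        refine lintegral_mono fun x => ?_
        dsimp only
        gcongr
        calc ∏ i, g (x + r * z i) ≤ ∏ i : Fin m, C := by gcongr; exact hgC _
          _ = _ := by simp
    _ = _ := by rw [lintegral_mul_const _ hg, hgi, one_mul]

lemma hE_le (a : ℝ) {m : ℕ} (T : Fin (m + 1) → Fin (m + 1) → Prop)
    (hT : (SimpleGraph.fromRel T).Connected) (y : Fin (m + 1) → ℝ) (z : Fin m → ℂ) :
    hE a T y z ≤ (Metric.closedBall (0 : Fin m → ℂ) (m + 1 : ℕ)).indicator 1 z := by
  unfold hE
  split_ifs with h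
  · rw [indicator_of_mem]; · simp
    obtain ⟨e, he⟩ := h
    have := sector_dist T hT zero_le_one (Fin.cons 0 z) y e (fun i j => (he i j).1)
    rw [mem_closedBall_zero_iff, pi_norm_le_iff_of_nonneg (by positivity)]
    intro i
    simpa using this (e.symm i.succ) (e.symm 0)
  · simp

lemma vol_ne (m : ℕ) : volume (Metric.closedBall (0 : Fin m → ℂ) (m + 1 : ℕ)) ≠ ⊤ :=
  measure_closedBall_lt_top.ne

lemma hE_int_le (a : ℝ) {m : ℕ} (T : Fin (m + 1) → Fin (m + 1) → Prop)
    (hT : (SimpleGraph.fromRel T).Connected) (y : Fin (m + 1) → ℝ) :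
    ∫⁻ z, hE a T y z ≤ volume (Metric.closedBall (0 : Fin m → ℂ) (m + 1 : ℕ)) := by
  calc _ ≤ ∫⁻ z, (Metric.closedBall (0 : Fin m → ℂ) (m + 1 : ℕ)).indicator 1 z :=
        lintegral_mono (hE_le a T hT y)
    _ = _ := lintegral_indicator_one measurableSet_closedBall

lemma outer_tendsto (a : ℝ) (ha : 0 ≤ a) {m : ℕ} (T : Fin (m + 1) → Fin (m + 1) → Prop)
    (hT : (SimpleGraph.fromRel T).Connected) (Q : Measure (Fin (m + 1) → ℝ)) [IsFiniteMeasure Q]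
    (φ : ℕ → (Fin m → ℂ) → ENNReal) (hφm : ∀ n, Measurable (φ n)) (C : ENNReal) (hC : C ≠ ⊤)
    (hφC : ∀ n z, φ n z ≤ C) (I : ENNReal) (hφ : ∀ z, Tendsto (fun n => φ n z) atTop (𝓝 I)) :
    Tendsto (fun n => ∫⁻ y, (∫⁻ z, hE a T y z * φ n z) ∂Q) atTop
      (𝓝 (∫⁻ y, (∫⁻ z, hE a T y z * I) ∂Q)) := by
  have hb : ∀ n y z, hE a T y z * φ n z ≤
      (Metric.closedBall (0 : Fin m → ℂ) (m + 1 : ℕ)).indicator 1 z * C := fun n y z =>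
    mul_le_mul' (hE_le a T hT y z) (hφC n z)
  have hbi : ∫⁻ z, (Metric.closedBall (0 : Fin m → ℂ) (m + 1 : ℕ)).indicator 1 z * C =
      volume (Metric.closedBall (0 : Fin m → ℂ) (m + 1 : ℕ)) * C := by
    rw [lintegral_mul_const _ (measurable_one.indicator measurableSet_closedBall),
      lintegral_indicator_one measurableSet_closedBall]
  have hbt : volume (Metric.closedBall (0 : Fin m → ℂ) (m + 1 : ℕ)) * C ≠ ⊤ :=
    ENNReal.mul_ne_top (vol_ne m) hC
  refine tendsto_lintegral_of_dominated_convergence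
    (fun _ => volume (Metric.closedBall (0 : Fin m → ℂ) (m + 1 : ℕ)) * C) ?_ ?_ ?_ ?_
  · intro n
    exact Measurable.lintegral_prod_right' (ν := volume) ((hE_meas a ha T).mul ((hφm n).comp measurable_snd))
  · intro n
    refine Eventually.of_forall fun y => ?_
    dsimp only
    rw [← hbi]
    exact lintegral_mono (hb n y)
  · rw [lintegral_const]; exact ENNReal.mul_ne_top hbt (by finiteness)
  · refine Eventually.of_forall fun y => ?_
    refine tendsto_lintegral_of_dominated_convergence
      (fun z => (Metric.closedBall (0 : Fin m → ℂ) (m + 1 : ℕ)).indicator 1 z * C) ?_ ?_ ?_ ?_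
    · exact fun n => (hE_meas1 a ha T y).mul (hφm n)
    · exact fun n => Eventually.of_forall (hb n y)
    · rw [hbi]; exact hbt
    · refine Eventually.of_forall fun z => ENNReal.Tendsto.const_mul (hφ z) (Or.inr ?_)
      unfold hE; split_ifs <;> simp

/-- the uniform law of inclinations -/
def unif : Measure ℝ := (ENNReal.ofReal (2 * π))⁻¹ • volume.restrict (Set.Ico 0 (2 * π))

instance : IsProbabilityMeasure unif := by
  constructor
  simp only [unif, Measure.smul_apply, Measure.restrict_apply MeasurableSet.univ, univ_inter,
    Real.volume_Ico, sub_zero, smul_eq_mul]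
  exact ENNReal.inv_mul_cancel (by simp [Real.pi_pos]) ENNReal.ofReal_ne_top

lemma pi_unif (k : ℕ) : (Measure.pi fun _ : Fin k => unif) =
    ENNReal.ofReal ((2 * π) ^ k)⁻¹ • (volume : Measure (Fin k → ℝ)).restrict
      (Set.univ.pi (fun _ : Fin k => Set.Ico 0 (2 * π))) := by
  refine Measure.pi_eq fun s hs => ?_
  rw [Measure.smul_apply, volume_pi, Measure.restrict_pi_pi, Measure.pi_pi]
  simp only [unif, Measure.smul_apply, smul_eq_mul, Finset.prod_mul_distrib, Finset.prod_const]
  congr 1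
  rw [← inv_pow, ENNReal.ofReal_pow (by positivity), ENNReal.ofReal_inv_of_pos (by positivity)]
  simp

lemma muT_eq (a : ℝ) (ha : 0 ≤ a) {m : ℕ} (T : Fin (m + 1) → Fin (m + 1) → Prop)
    (hT : (SimpleGraph.fromRel T).Connected) (f : ℂ → ℝ) (hf0 : ∀ x, 0 ≤ f x)
    (hfm : AEStronglyMeasurable f volume) :
    muT a (m + 1) T f = (1 / (m + 1).factorial) *
      (∫⁻ y, (∫⁻ z, hE a T y z * ∫⁻ x, ENNReal.ofReal (f x ^ (m + 1)))
        ∂(Measure.pi fun _ : Fin (m + 1) => unif)).toReal := by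
  set I := ∫⁻ x, ENNReal.ofReal (f x ^ (m + 1)) with hI
  have hIr : ∫ x, f x ^ (m + 1) = I.toReal :=
    integral_eq_lintegral_of_nonneg_ae (Eventually.of_forall fun x => pow_nonneg (hf0 x) _) (hfm.pow _)
  have hpts : ∀ z : Fin m → ℂ, (pts (k := m + 1) z) = Fin.cons 0 z := by
    intro z; funext i
    refine Fin.cases ?_ (fun i => ?_) i <;> simp [pts]
  have hh : ∀ y z, hInd a T (pts (k := m + 1) z) y = (hE a T y z).toReal := by
    intro y z
    rw [hpts]
    unfold hInd hE
    split_ifs <;> simp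
  have h1 : ∀ y, ∫ z : Fin m → ℂ, ∫ x : ℂ, hInd a T (pts (k := m + 1) z) y * f x ^ (m + 1) =
      (∫⁻ z, hE a T y z * I).toReal := by
    intro y
    simp only [integral_const_mul, integral_mul_const, hh, hIr]
    rw [lintegral_mul_const _ (hE_meas1 a ha T y), ENNReal.toReal_mul,
      integral_toReal (hE_meas1 a ha T y).aemeasurable]
    refine Eventually.of_forall fun z => ?_
    unfold hE; split_ifs <;> simp
  unfold muT
  have h3 : Measurable fun y => ∫⁻ z, hE a T y z :=
    Measurable.lintegral_prod_right' (ν := volume) (hE_meas a ha T)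
  have h4 : (∫⁻ y, (∫⁻ z, hE a T y z * I) ∂(Measure.pi fun _ : Fin (m + 1) => unif)).toReal
    = ((2 * π) ^ (m + 1))⁻¹ * ∫ y in Set.univ.pi (fun _ : Fin (m + 1) => Set.Ico 0 (2 * π)),
      (∫⁻ z, hE a T y z * I).toReal := by
    simp only [lintegral_mul_const _ (hE_meas1 a ha T _), ENNReal.toReal_mul]
    rw [integral_mul_const, lintegral_mul_const _ h3, pi_unif, lintegral_smul_measure,
      smul_eq_mul, ENNReal.toReal_mul, ENNReal.toReal_mul, ENNReal.toReal_ofReal (by positivity),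
      integral_toReal h3.aemeasurable, mul_assoc]
    exact Eventually.of_forall fun y => (hE_int_le a T hT y).trans_lt (vol_ne m).lt_top
  rw [h4, ← mul_assoc]
  congr 1
  · field_simp
  · exact integral_congr_ae (Eventually.of_forall h1)



lemma aemeas_f (f : ℂ → ℝ) (hfc : ∀ᵐ x : ℂ, ContinuousAt f x) : AEMeasurable f volume := by
  have hs : MeasurableSet {x | ContinuousAt f x} := (IsGδ.setOfPred_continuousAt f).measurableSet
  have h : ContinuousOn f {x | ContinuousAt f x} := fun x hx => ContinuousAt.continuousWithinAt hx
  have := h.aemeasurable (μ := volume) hs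
  rwa [Measure.restrict_eq_self_of_ae_mem (s := {x | ContinuousAt f x}) hfc] at this

lemma choose_tendsto (k : ℕ) : Tendsto (fun n : ℕ => (n.choose k : ℝ) / (n : ℝ) ^ k) atTop
    (𝓝 (1 / k.factorial)) := by
  have h := isEquivalent_choose k
  have h2 := (Asymptotics.isEquivalent_iff_tendsto_one ?_).1 h
  · have h3 := h2.div_const (k.factorial : ℝ)
    refine h3.congr' ?_
    filter_upwards [eventually_gt_atTop 0] with n hn
    have : (k.factorial : ℝ) ≠ 0 := by positivity
    have : (n : ℝ) ≠ 0 := by positivity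
    simp only [Pi.div_apply]
    field_simp
  · filter_upwards [eventually_gt_atTop 0] with n hn
    positivity

lemma mean_tendsto (f : ℂ → ℝ) (hf0 : ∀ x, 0 ≤ f x) (C : ℝ) (hfb : ∀ x, f x ≤ C)
    (hfc : ∀ᵐ x : ℂ, ContinuousAt f x)
    [IsProbabilityMeasure (volume.withDensity fun x => ENNReal.ofReal (f x))]
    (a : ℝ) (ha : 0 ≤ a) {m : ℕ} (T : Fin (m + 1) → Fin (m + 1) → Prop)
    (hT : (SimpleGraph.fromRel T).Connected)
    (r : ℕ → ℝ) (hrpos : ∀ n, 0 < r n) (hr0 : Tendsto r atTop (𝓝 0)) :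
    Tendsto (fun n : ℕ => (∫ w : Fin n → ℂ × ℝ, cnt a (r n) T w ∂(Measure.pi fun _ =>
        (volume.withDensity fun x => ENNReal.ofReal (f x)).prod unif)) /
        ((n : ℝ) ^ (m + 1) * r n ^ (2 * m))) atTop (𝓝 (muT a (m + 1) T f)) := by
  have hfm := aemeas_f f hfc
  let g : ℂ → ENNReal := fun x => ENNReal.ofReal (min C (hfm.mk f x))
  have hg : Measurable g := (measurable_const.min hfm.measurable_mk).ennreal_ofReal
  have hgf : ∀ᵐ x, g x = ENNReal.ofReal (f x) := by
    filter_upwards [hfm.ae_eq_mk] with x hx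
    simp only [g]
    rw [← hx, min_eq_right (hfb x)]
  have hgC : ∀ x, g x ≤ ENNReal.ofReal C := fun x => ENNReal.ofReal_le_ofReal (min_le_left _ _)
  have hwd : volume.withDensity (fun x => ENNReal.ofReal (f x)) = volume.withDensity g :=
    withDensity_congr_ae (by filter_upwards [hgf] with x hx using hx.symm)
  have hPg : IsProbabilityMeasure (volume.withDensity g) := by rw [← hwd]; infer_instance
  have hgi : ∫⁻ x, g x = 1 := by
    have := hPg.measure_univ
    rwa [withDensity_apply _ MeasurableSet.univ, Measure.restrict_univ] at this
  set I := ∫⁻ x, ENNReal.ofReal (f x ^ (m + 1)) with hI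
  have key := outer_tendsto a ha T hT (Measure.pi fun _ : Fin (m + 1) => unif)
    (fun n z => ∫⁻ x : ℂ, g x * ∏ i, g (x + r n * z i)) (fun n => by
      have hpm2 : Measurable fun p : (Fin m → ℂ) × ℂ => g p.2 * ∏ i, g (p.2 + r n * p.1 i) := by
        refine (hg.comp measurable_snd).mul (Finset.measurable_fun_prod _ fun i _ => hg.comp (by fun_prop))
      exact Measurable.lintegral_prod_right' hpm2) (ENNReal.ofReal C ^ m) (by finiteness)
    (fun n z => phi_le _ g hg hgC hgi (r n) z) I
    (fun z => phi_tendsto f hf0 C hfc g hg hgC hgf (by simp [hgi]) r hr0 z)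
  have hIt : I ≠ ⊤ := by
    have h : ∀ x, ENNReal.ofReal (f x ^ (m + 1)) ≤ ENNReal.ofReal (f x) * ENNReal.ofReal C ^ m := by
      intro x
      rw [ENNReal.ofReal_pow (hf0 x), pow_succ']
      gcongr
      exact hfb x
    refine ((lintegral_mono h).trans_lt ?_).ne
    rw [lintegral_mul_const'' _ hfm.ennreal_ofReal, ← lintegral_congr_ae hgf, hgi, one_mul]
    finiteness
  have hfin : (∫⁻ y, (∫⁻ z, hE a T y z * I) ∂(Measure.pi fun _ : Fin (m + 1) => unif)) ≠ ⊤ := by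
    refine ((lintegral_mono (g := fun _ => volume (Metric.closedBall (0 : Fin m → ℂ) (m + 1 : ℕ)) * I)
      fun y => ?_).trans_lt ?_).ne
    · dsimp only
      rw [lintegral_mul_const _ (hE_meas1 a ha T y)]
      gcongr
      exact hE_int_le a T hT y
    · rw [lintegral_const, measure_univ, mul_one]
      exact (ENNReal.mul_ne_top (vol_ne m) hIt).lt_top
  have key2 := (ENNReal.tendsto_toReal hfin).comp key
  rw [muT_eq a ha T hT f hf0 hfm.aestronglyMeasurable]
  refine ((choose_tendsto (m + 1)).mul key2).congr fun n => ?_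
  rw [integral_cnt _ _ _ ha, hwd, measureReal_def, theta_eq g hg unif a (r n) ha (hrpos n) T,
    ENNReal.toReal_mul, ENNReal.toReal_ofReal (by have := hrpos n; positivity)]
  have := (hrpos n).ne'
  simp only [Function.comp_apply]
  rw [mul_div_mul_comm, mul_div_cancel_left₀ _ (by positivity)]

lemma ball_bound (f : ℂ → ℝ) (C : ℝ) (hC : 0 ≤ C) (hfb : ∀ x, f x ≤ C)
    (t : ℂ) (R : ℝ) (hR : 0 ≤ R) :
    ((volume.withDensity fun x => ENNReal.ofReal (f x)).prod unif).real {e | ‖e.1 - t‖ ≤ R} ≤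
      C * (π * R ^ 2) := by
  have h : {e : ℂ × ℝ | ‖e.1 - t‖ ≤ R} = Metric.closedBall t R ×ˢ univ := by
    ext e; simp [dist_eq_norm]
  have h2 : (volume.withDensity fun x => ENNReal.ofReal (f x)) (Metric.closedBall t R) ≤
      ENNReal.ofReal (C * (π * R ^ 2)) := by
    rw [withDensity_apply _ measurableSet_closedBall]
    calc _ ≤ ∫⁻ x in Metric.closedBall t R, ENNReal.ofReal C :=
          lintegral_mono fun x => ENNReal.ofReal_le_ofReal (hfb x)
      _ = _ := by
          rw [setLIntegral_const, Complex.volume_closedBall, ENNReal.ofReal_mul hC,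
            ENNReal.ofReal_mul Real.pi_pos.le, ← ENNReal.ofReal_pow hR, mul_comm (ENNReal.ofReal π)]
          congr 2
          rw [ENNReal.ofReal_eq_coe_nnreal Real.pi_pos.le]; rfl
  rw [h, measureReal_prod_prod, probReal_univ, mul_one]
  exact ENNReal.toReal_le_of_le_ofReal (by positivity) h2

lemma numer (n : ℕ) (hn : 1 ≤ n) (t c δ : ℝ) (hc : 0 < c) (ht : c * (n : ℝ) ^ ((δ - 1) / 2) ≤ t)
    (q : ℕ) (hq : 1 ≤ q) (hqd : 1 ≤ q * δ) (hδ : 0 < δ) (A B : ℝ) (hA : 0 ≤ A) (hB : 0 ≤ B) :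
    (n : ℝ) ^ (q + 1) * (A * t + B * t ^ (2 * (q + 1))) / (n * t) ^ (2 * (q + 1)) ≤
      (A * (c ^ (2 * q + 1))⁻¹ + B) * (n : ℝ) ^ (-(3 / 2) : ℝ) := by
  have hn0 : (0 : ℝ) < n := by positivity
  have hn1 : (1 : ℝ) ≤ n := by exact_mod_cast hn
  have hnp : 0 < (n : ℝ) ^ ((δ - 1) / 2) := by positivity
  have ht0 : 0 < t := lt_of_lt_of_le (by positivity) ht
  have e1 : (n : ℝ) ^ (q + 1) * (A * t + B * t ^ (2 * (q + 1))) / (n * t) ^ (2 * (q + 1)) =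
      A * ((n : ℝ) ^ (q + 1) * t ^ (2 * q + 1))⁻¹ + B * ((n : ℝ) ^ (q + 1))⁻¹ := by
    have : 2 * (q + 1) = (q + 1) + (q + 1) := by ring
    have h2 : t ^ (2 * (q + 1)) = t ^ (2 * q + 1) * t := by rw [← pow_succ]; ring_nf
    rw [mul_pow, h2, this, pow_add (n : ℝ)]
    field_simp
    ring
  rw [e1, rpow_neg hn0.le, add_mul]
  have h3 : (n : ℝ) ^ ((3 : ℝ) / 2) ≤ (n : ℝ) ^ (q + 1) := by
    rw [← rpow_natCast]
    refine rpow_le_rpow_of_exponent_le hn1 ?_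
    have : (1 : ℝ) ≤ q := by exact_mod_cast hq
    push_cast; linarith
  have h4 : c ^ (2 * q + 1) * (n : ℝ) ^ ((3 : ℝ) / 2) ≤ (n : ℝ) ^ (q + 1) * t ^ (2 * q + 1) := by
    have h5 : (c * (n : ℝ) ^ ((δ - 1) / 2)) ^ (2 * q + 1) ≤ t ^ (2 * q + 1) := by gcongr
    have h6 : (n : ℝ) ^ ((3 : ℝ) / 2) ≤ (n : ℝ) ^ (q + 1) * ((n : ℝ) ^ ((δ - 1) / 2)) ^ (2 * q + 1) := by
      rw [← rpow_natCast, ← rpow_natCast ((n : ℝ) ^ ((δ - 1) / 2)), ← rpow_mul hn0.le, ← rpow_add hn0]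
      refine rpow_le_rpow_of_exponent_le hn1 ?_
      push_cast; nlinarith
    calc _ ≤ c ^ (2 * q + 1) * ((n : ℝ) ^ (q + 1) * ((n : ℝ) ^ ((δ - 1) / 2)) ^ (2 * q + 1)) := by gcongr
      _ = (n : ℝ) ^ (q + 1) * (c * (n : ℝ) ^ ((δ - 1) / 2)) ^ (2 * q + 1) := by rw [mul_pow]; ring
      _ ≤ _ := by gcongr
  rw [mul_assoc, ← mul_inv]
  gcongr

lemma ae_tendsto_zero {Ω : Type*} [MeasurableSpace Ω] (P : Measure Ω) (Y : ℕ → Ω → ℝ)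
    (hY : ∀ n, Measurable (Y n)) (j : ℕ) (hj : j ≠ 0) (b : ℕ → ℝ) (hb0 : ∀ n, 0 ≤ b n) (hb : Summable b)
    (h : ∀ᶠ n in atTop, ∫⁻ ω, ENNReal.ofReal (Y n ω ^ (2 * j)) ∂P ≤ ENNReal.ofReal (b n)) :
    ∀ᵐ ω ∂P, Tendsto (fun n => Y n ω) atTop (𝓝 0) := by
  obtain ⟨N, hN⟩ := eventually_atTop.1 h
  have h1 : ∫⁻ ω, ∑' n, ENNReal.ofReal (Y (n + N) ω ^ (2 * j)) ∂P ≠ ⊤ := by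
    rw [lintegral_tsum fun n => ((hY _).pow_const _).ennreal_ofReal.aemeasurable]
    refine ((ENNReal.tsum_le_tsum fun n => hN (n + N) (by omega)).trans_lt ?_).ne
    rw [← ENNReal.ofReal_tsum_of_nonneg (fun n => hb0 _) ((summable_nat_add_iff N).2 hb)]
    exact ENNReal.ofReal_lt_top
  have h2 := ae_lt_top (Measurable.tsum fun n => ((hY _).pow_const _).ennreal_ofReal) h1
  filter_upwards [h2] with ω hω
  rw [← tendsto_add_atTop_iff_nat N]
  have h3 := ENNReal.tendsto_atTop_zero_of_tsum_ne_top hω.ne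
  have h4 := (ENNReal.tendsto_toReal (by simp)).comp h3
  have h5 : Tendsto (fun n => Y (n + N) ω ^ (2 * j)) atTop (𝓝 0) := by
    refine h4.congr fun n => ?_
    simp only [Function.comp_apply]
    rw [ENNReal.toReal_ofReal ((even_two_mul j).pow_nonneg _)]
  rw [tendsto_zero_iff_abs_tendsto_zero]
  have h6 := h5.rpow_const (p := ((2 * j : ℕ) : ℝ)⁻¹) (Or.inr (by positivity))
  rw [zero_rpow (by positivity)] at h6
  refine h6.congr fun n => ?_
  rw [← (even_two_mul j).pow_abs, pow_rpow_inv_natCast (abs_nonneg _) (by omega)]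
  rfl


/-- Theorem 4: strong law of large numbers for the number of induced
`T`-subdigraphs when `f` has bounded support, `rₙ → 0` and
`liminf n^{2k-1-δ} rₙ^{4(k-1)} > 0` for some `δ > 0`. -/
theorem statement3
    {Ω : Type} [MeasureSpace Ω] [IsProbabilityMeasure (ℙ : Measure Ω)]
    -- the common density of the points, bounded and a.e. continuous
    (f : ℂ → ℝ) (hf0 : ∀ x, 0 ≤ f x) (hfb : ∃ C, ∀ x, f x ≤ C)
    (hfc : ∀ᵐ x : ℂ, ContinuousAt f x)
    -- the central angle α ∈ (0, 2π]
    (a : ℝ) (ha : 0 < a) (ha' : a ≤ 2 * π)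
    -- `Z i = (Xᵢ, Yᵢ)`: i.i.d., `Xᵢ` with density `f`, `Yᵢ` uniform on `[0, 2π)`,
    -- the `Xᵢ` independent of the `Yᵢ`
    (Z : ℕ → Ω → ℂ × ℝ) (hZm : ∀ i, Measurable (Z i))
    (hZi : iIndepFun Z ℙ)
    (hZd : ∀ i, Measure.map (Z i) ℙ =
      (volume.withDensity fun x => ENNReal.ofReal (f x)).prod
        ((ENNReal.ofReal (2 * π))⁻¹ • volume.restrict (Set.Ico 0 (2 * π))))
    -- `T` a feasible connected digraph of order `k`
    (k : ℕ) (hk : 2 ≤ k) (T : Fin k → Fin k → Prop) (hTirr : ∀ i, ¬ T i i)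
    (hTconn : (SimpleGraph.fromRel T).Connected)
    (hTfeas : ∃ ρ : ℝ, 0 < ρ ∧
      0 < ℙ {ω | isoT a ρ T (fun i : Fin k => (Z i ω).1) (fun i : Fin k => (Z i ω).2)})
    -- the positive cutoffs
    (r : ℕ → ℝ) (hrpos : ∀ n, 0 < r n)
    (hsupp : Bornology.IsBounded (Function.support f))
    (hr0 : Tendsto r atTop (𝓝 0))
    (δ : ℝ) (hδ : 0 < δ)
    (hliminf : 0 < Filter.liminf
      (fun n : ℕ => (n : ℝ) ^ ((2 * (k : ℝ) - 1) - δ) * r n ^ (4 * (k - 1))) atTop) :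
    ∀ᵐ ω ∂ℙ, Tendsto (fun n : ℕ =>
        (inducedCount a (r n) T
          (fun i : Fin n => (Z i ω).1) (fun i : Fin n => (Z i ω).2) : ℝ) /
          ((n : ℝ) ^ k * r n ^ (2 * (k - 1))))
      atTop (𝓝 (muT a k T f)) := by
  obtain ⟨m, rfl⟩ : ∃ m, k = m + 1 := ⟨k - 1, by omega⟩
  simp only [Nat.add_sub_cancel] at hliminf ⊢
  obtain ⟨C0, hC0⟩ := hfb
  set C := max C0 0 with hCdef
  have hC : 0 ≤ C := le_max_right _ _
  have hfb : ∀ x, f x ≤ C := fun x => (hC0 x).trans (le_max_left _ _)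
  set ν := volume.withDensity fun x => ENNReal.ofReal (f x) with hν
  have hZd' : ∀ i, Measure.map (Z i) ℙ = ν.prod unif := hZd
  have hμ : IsProbabilityMeasure (ν.prod unif) := by
    rw [← hZd' 0]; exact Measure.isProbabilityMeasure_map (hZm 0).aemeasurable
  have hνp : IsProbabilityMeasure ν := by
    constructor
    have h := hμ.measure_univ
    rw [← univ_prod_univ, Measure.prod_prod, measure_univ (μ := unif), mul_one] at h
    exact h
  -- the mean
  have hmean := mean_tendsto f hf0 C hfb hfc a ha.le T hTconn r hrpos hr0
  set E : ℕ → ℝ := fun n => ∫ w : Fin n → ℂ × ℝ, cnt a (r n) T w ∂(Measure.pi fun _ => ν.prod unif)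
    with hE'
  set s : ℕ → ℝ := fun n => (n : ℝ) ^ (m + 1) * r n ^ (2 * m) with hs
  -- the exponent
  obtain ⟨q0, hq0⟩ := exists_nat_ge (1 / δ)
  set q := q0 + 1 with hq
  have hqd : 1 ≤ (q : ℝ) * δ := by
    have : 1 / δ ≤ (q : ℝ) := hq0.trans (by simp [hq])
    rwa [div_le_iff₀ hδ] at this
  obtain ⟨K, hK0, hK⟩ := integral_cnt_center (ν.prod unif) m q
  -- lower bound from the liminf
  obtain ⟨c, hc, hcn⟩ : ∃ c : ℝ, 0 < c ∧ ∀ᶠ n : ℕ in atTop,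
      c ≤ (n : ℝ) ^ ((2 * ((m + 1 : ℕ) : ℝ) - 1) - δ) * r n ^ (4 * m) := by
    rw [liminf_eq] at hliminf
    by_contra hcon
    refine hliminf.not_ge (Real.sSup_nonpos fun c hc => ?_)
    by_contra! hc0
    exact hcon ⟨c, hc0, hc⟩
  set D : ℝ := C * (π * (m + 1 : ℕ) ^ 2) with hD
  have hD0 : 0 ≤ D := by positivity
  set A : ℝ := K * D ^ m with hA
  set B : ℝ := K * D ^ (2 * (q + 1) * m) with hB
  have hA0 : 0 ≤ A := by positivity
  have hB0 : 0 ≤ B := by positivity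
  let W : (n : ℕ) → Ω → (Fin n → ℂ × ℝ) := fun n ω i => Z i ω
  have hWm : ∀ n, Measurable (W n) := fun n => measurable_pi_iff.2 fun i => hZm i
  have hW : ∀ n, Measure.map (W n) ℙ = Measure.pi fun _ : Fin n => ν.prod unif := fun n =>
    law_comp hZm hZi hZd' (fun i : Fin n => (i : ℕ)) Fin.val_injective
  have hae := ae_tendsto_zero (ℙ : Measure Ω) (fun n ω => (cnt a (r n) T (W n ω) - E n) / s n)
    (fun n => (((cnt_meas a (r n) ha.le T).comp (hWm n)).sub_const _).div_const _) (q + 1) (by omega)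
    (fun n => (A * (√c ^ (2 * q + 1))⁻¹ + B) * (n : ℝ) ^ (-(3 / 2) : ℝ)) (fun n => by positivity)
    ((summable_nat_rpow.2 (by norm_num)).mul_left _) ?_
  · filter_upwards [hae] with ω hω
    have h := hω.add hmean
    rw [zero_add] at h
    refine h.congr fun n => ?_
    rw [← add_div, sub_add_cancel]
    rw [← inducedCount_eq]
  · filter_upwards [hcn, eventually_ge_atTop 1] with n hcn hn
    have hrn := hrpos n
    have hn0 : (0 : ℝ) < n := by positivity
    set t : ℝ := (n * r n ^ 2) ^ m with ht
    have hst : s n = n * t := by simp only [hs, ht]; rw [mul_pow, pow_succ', ← pow_mul, mul_assoc]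
    have ht0 : 0 < t := by positivity
    have htc : √c * (n : ℝ) ^ ((δ - 1) / 2) ≤ t := by
      have h1 : c * (n : ℝ) ^ (δ - 1) ≤ t ^ 2 := by
        calc c * (n : ℝ) ^ (δ - 1) ≤ ((n : ℝ) ^ ((2 * ((m + 1 : ℕ) : ℝ) - 1) - δ) * r n ^ (4 * m)) *
              (n : ℝ) ^ (δ - 1) := by gcongr
          _ = ((n : ℝ) ^ ((2 * ((m + 1 : ℕ) : ℝ) - 1) - δ) * (n : ℝ) ^ (δ - 1)) * r n ^ (4 * m) := by ring
          _ = (n : ℝ) ^ (2 * m) * r n ^ (4 * m) := by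
              rw [← rpow_add hn0, ← rpow_natCast (n : ℝ) (2 * m)]
              congr 2
              push_cast; ring
          _ = t ^ 2 := by rw [ht, ← pow_mul, mul_pow, ← pow_mul]; ring_nf
      have h2 := Real.sqrt_le_sqrt h1
      rw [Real.sqrt_sq ht0.le, Real.sqrt_mul hc.le, Real.sqrt_eq_rpow (_ ^ _), ← rpow_mul hn0.le] at h2
      convert h2 using 3
      ring
    have hKn := hK a (r n) (D * r n ^ 2) ha.le hrn.le T hTconn (fun t => by
      refine (ball_bound f C hC hfb t _ (by positivity)).trans (le_of_eq ?_)
      rw [hD]; ring) n hn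
    have hmeas : Measurable fun w : Fin n → ℂ × ℝ => ((cnt a (r n) T w - E n) / s n) ^ (2 * (q + 1)) :=
      (((cnt_meas a (r n) ha.le T).sub_const _).div_const _).pow_const _
    have hlin : ∫⁻ ω, ENNReal.ofReal (((cnt a (r n) T (W n ω) - E n) / s n) ^ (2 * (q + 1))) ∂ℙ =
        ENNReal.ofReal (∫ w : Fin n → ℂ × ℝ, ((cnt a (r n) T w - E n) / s n) ^ (2 * (q + 1))
          ∂(Measure.pi fun _ => ν.prod unif)) := by
      rw [ofReal_integral_eq_lintegral_ofReal, ← hW n, lintegral_map hmeas.ennreal_ofReal (hWm n)]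
      · refine bint hmeas ?_
        obtain ⟨M, hM⟩ := cnt_bdd a (r n) T (n := n)
        refine ⟨((M + |E n|) / |s n|) ^ (2 * (q + 1)), fun w => ?_⟩
        rw [abs_pow, abs_div]
        gcongr
        exact (abs_sub _ _).trans (by gcongr; exact hM w)
      · exact Eventually.of_forall fun w => (even_two_mul _).pow_nonneg _
    rw [hlin]
    refine ENNReal.ofReal_le_ofReal ?_
    refine le_trans ?_ (numer n hn t (√c) δ (Real.sqrt_pos.2 hc) htc q (by omega) hqd hδ A B hA0 hB0)
    simp only [div_pow]
    rw [integral_div, hst]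
    gcongr
    refine hKn.trans (le_of_eq ?_)
    have e1 : ((n : ℝ) * (D * r n ^ 2)) ^ m = D ^ m * t := by rw [ht, ← mul_pow]; ring_nf
    have e2 : ((n : ℝ) * (D * r n ^ 2)) ^ (2 * (q + 1) * m) = D ^ (2 * (q + 1) * m) * t ^ (2 * (q + 1)) := by
      rw [ht, ← pow_mul, mul_comm m, ← mul_pow]; ring_nf
    rw [e1, e2, hA, hB]; ring

end
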